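/- Let n ≥ 1 and let X be a separable metrizable space. If X is an 𝔈_c-factor, i.e., there exists a topological space Z such that X × Z is homeomorphic to complete Erdős space 𝔈_c, then F_n(X) with the Vietoris topology is an 𝔈_c-factor. -/

import Mathlib

open Set Topology

noncomputable section

/-- The Vietoris topology on the powerset of `X` induced by a topology `τ`,
generated by the sets `{F | F ⊆ U}` and `{F | F ∩ U ≠ ∅}` for `U` a nonempty `τ`-open set. -/
def VietorisTop {X : Type*} (τ : TopologicalSpace X) : TopologicalSpace (Set X) :=
  TopologicalSpace.generateFrom
    ({S : Set (Set X) | ∃ U : Set X, IsOpen[τ] U ∧ U.Nonempty ∧ S = {F : Set X | F ⊆ U}} ∪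
     {S : Set (Set X) | ∃ U : Set X, IsOpen[τ] U ∧ U.Nonempty ∧ S = {F : Set X | (F ∩ U).Nonempty}})

/-- The hyperspace `K(X)` of nonempty compact subsets of `X`. -/
def HypK (X : Type*) [TopologicalSpace X] : Type _ := {F : Set X // F.Nonempty ∧ IsCompact F}

/-- `K(X)` carries the Vietoris topology. -/
instance (X : Type*) [τ : TopologicalSpace X] : TopologicalSpace (HypK X) :=
  (VietorisTop τ).induced Subtype.val

/-- The `n`-th symmetric product `F_n(X)`: nonempty subsets of `X` with at most `n` points. -/
def HypFn (n : ℕ) (X : Type*) [TopologicalSpace X] : Type _ :=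
  {F : Set X // F.Nonempty ∧ F.Finite ∧ F.ncard ≤ n}

/-- `F_n(X)` carries the Vietoris topology. -/
instance (n : ℕ) (X : Type*) [τ : TopologicalSpace X] : TopologicalSpace (HypFn n X) :=
  (VietorisTop τ).induced Subtype.val

/-- The hyperspace `F(X)` of nonempty finite subsets of `X`. -/
def HypFin (X : Type*) [TopologicalSpace X] : Type _ := {F : Set X // F.Nonempty ∧ F.Finite}

/-- `F(X)` carries the Vietoris topology. -/
instance (X : Type*) [τ : TopologicalSpace X] : TopologicalSpace (HypFin X) :=
  (VietorisTop τ).induced Subtype.val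

/-- A space is almost zero-dimensional if every point has a neighborhood basis consisting of
sets each of which is an intersection of clopen sets. -/
def IsAZD (X : Type*) [TopologicalSpace X] : Prop :=
  ∀ x : X, ∀ U ∈ nhds x, ∃ V ∈ nhds x, V ⊆ U ∧
    ∃ C : Set (Set X), (∀ c ∈ C, IsClopen c) ∧ V = ⋂₀ C

/-- `X` is `𝒜`-cohesive: every point has a neighborhood containing no nonempty proper
subset of an element `A ∈ 𝒜` that is clopen in the subspace topology of `A`. -/
def CohesiveWrt (X : Type*) [TopologicalSpace X] (𝒜 : Set (Set X)) : Prop :=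
  ∀ x : X, ∃ U ∈ nhds x, ∀ A ∈ 𝒜, ∀ C : Set X,
    C ⊆ U → C ⊆ A → C.Nonempty → C ≠ A → ¬ IsClopen {y : A | (y : X) ∈ C}

/-- A space is cohesive if it is `{X}`-cohesive. -/
def Cohesive (X : Type*) [TopologicalSpace X] : Prop := CohesiveWrt X {Set.univ}

/-- Erdős space: the rational points of the Hilbert space `ℓ²`. -/
def ErdosSpace : Type :=
  {x : lp (fun _ : ℕ => ℝ) 2 // ∀ n : ℕ, ∃ q : ℚ, x.val n = (q : ℝ)}

instance : TopologicalSpace ErdosSpace := by unfold ErdosSpace; infer_instance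

/-- Complete Erdős space: points of `ℓ²` all of whose coordinates lie in `{0} ∪ {1/m : m ≥ 1}`. -/
def CompleteErdosSpace : Type :=
  {x : lp (fun _ : ℕ => ℝ) 2 // ∀ n : ℕ, x.val n = 0 ∨ ∃ m : ℕ, 0 < m ∧ x.val n = 1 / (m : ℝ)}

instance : TopologicalSpace CompleteErdosSpace := by unfold CompleteErdosSpace; infer_instance

open Filter
open scoped ENNReal

/-- The set of points where an extended-valued function is finite, with the topology of the
graph of the function. -/
def GraphDomain {C : Type*} (N : C → ℝ≥0∞) : Type _ := {c : C // N c ≠ ∞}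

namespace GraphDomain

variable {C D Y : Type*} [TopologicalSpace C] [TopologicalSpace D] [TopologicalSpace Y]
  {N : C → ℝ≥0∞} {M : D → ℝ≥0∞}

instance : TopologicalSpace (GraphDomain N) :=
  TopologicalSpace.induced (fun c => (c.1, N c.1)) inferInstance

theorem continuous_graph : Continuous (fun c : GraphDomain N => (c.1, N c.1)) :=
  continuous_induced_dom

theorem continuous_val : Continuous (fun c : GraphDomain N => c.1) :=
  continuous_fst.comp continuous_graph

theorem continuous_apply : Continuous (fun c : GraphDomain N => N c.1) :=
  continuous_snd.comp continuous_graph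

theorem continuous_iff {g : Y → GraphDomain N} :
    Continuous g ↔ Continuous (fun y => (g y).1) ∧ Continuous (fun y => N (g y).1) := by
  refine ⟨fun h => ⟨continuous_val.comp h, continuous_apply.comp h⟩, fun h => ?_⟩
  exact continuous_induced_rng.2 (h.1.prodMk h.2)

theorem tendsto_iff {α : Type*} {l : Filter α} {g : α → GraphDomain N} {c : GraphDomain N} :
    Tendsto g l (𝓝 c) ↔
      Tendsto (fun y => (g y).1) l (𝓝 c.1) ∧ Tendsto (fun y => N (g y).1) l (𝓝 (N c.1)) := by
  rw [nhds_induced, tendsto_comap_iff, nhds_prod_eq]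
  exact tendsto_prod_iff'

end GraphDomain

theorem ENNReal.tendsto_of_tendsto_add {α : Type*} {l : Filter α} {f g : α → ℝ≥0∞} {a b : ℝ≥0∞}
    (hf : ∀ r < a, ∀ᶠ y in l, r < f y) (hg : ∀ r < b, ∀ᶠ y in l, r < g y)
    (h : Tendsto (fun y => f y + g y) l (𝓝 (a + b))) (hab : a + b ≠ ∞) :
    Tendsto f l (𝓝 a) := by
  have ha : a ≠ ∞ := fun h => hab (by simp [h])
  have hb : b ≠ ∞ := fun h => hab (by simp [h])
  refine tendsto_order.2 ⟨hf, fun r hr => ?_⟩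
  obtain ⟨r', har', hr'r⟩ := exists_between hr
  have hδ : r' - a ≠ 0 := (tsub_pos_of_lt har').ne'
  have hδ2 : (r' - a) / 2 ≠ 0 := by simpa using hδ
  have h1 : ∀ᶠ y in l, b ≤ g y + (r' - a) / 2 := by
    rcases eq_or_ne b 0 with rfl | hb0
    · simp
    · filter_upwards [hg (b - (r' - a) / 2) (ENNReal.sub_lt_self hb hb0 hδ2)] with y hy
      exact tsub_le_iff_right.1 hy.le
  have h2 : ∀ᶠ y in l, f y + g y < a + b + (r' - a) / 2 :=
    (tendsto_order.1 h).2 _ (ENNReal.lt_add_right hab hδ2)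
  filter_upwards [h1, h2] with y hy1 hy2
  have h3 : f y + b < r' + b := by
    calc f y + b ≤ f y + (g y + (r' - a) / 2) := by gcongr
      _ = (f y + g y) + (r' - a) / 2 := by ring
      _ < (a + b + (r' - a) / 2) + (r' - a) / 2 :=
        ENNReal.add_lt_add_right (ENNReal.div_ne_top (ENNReal.sub_ne_top hr'r.ne_top) (by simp)) hy2
      _ = a + b + ((r' - a) / 2 + (r' - a) / 2) := by ring
      _ = a + (r' - a) + b := by rw [ENNReal.add_halves]; ring
      _ = r' + b := by rw [add_tsub_cancel_of_le har'.le]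
  exact ((ENNReal.add_lt_add_iff_right hb).1 h3).trans hr'r

theorem LowerSemicontinuous.eventually_lt {C α : Type*} [TopologicalSpace C] {N : C → ℝ≥0∞}
    (hN : LowerSemicontinuous N) {l : Filter α} {u : α → C} {c : C} (hu : Tendsto u l (𝓝 c)) :
    ∀ r < N c, ∀ᶠ y in l, r < N (u y) :=
  fun r hr => hu.eventually (hN c r hr)

/-- The product of two graph domains is the graph domain of the sum. -/
def GraphDomain.prodHomeomorph {C D : Type*} [TopologicalSpace C] [TopologicalSpace D]
    {N : C → ℝ≥0∞} {M : D → ℝ≥0∞} (hN : LowerSemicontinuous N) (hM : LowerSemicontinuous M) :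
    GraphDomain N × GraphDomain M ≃ₜ GraphDomain (fun p : C × D => N p.1 + M p.2) where
  toFun p := ⟨(p.1.1, p.2.1), by simpa using ⟨p.1.2, p.2.2⟩⟩
  invFun p := (⟨p.1.1, fun h => p.2 (by simp [h])⟩, ⟨p.1.2, fun h => p.2 (by simp [h])⟩)
  left_inv _ := rfl
  right_inv _ := rfl
  continuous_toFun := by
    refine continuous_iff.2 ⟨?_, ?_⟩
    · exact (continuous_val.comp continuous_fst).prodMk (continuous_val.comp continuous_snd)
    · exact (continuous_apply.comp continuous_fst).add (continuous_apply.comp continuous_snd)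
  continuous_invFun := by
    have h1 : Continuous fun p : GraphDomain (fun p : C × D => N p.1 + M p.2) => p.1.1 :=
      continuous_fst.comp continuous_val
    have h2 : Continuous fun p : GraphDomain (fun p : C × D => N p.1 + M p.2) => p.1.2 :=
      continuous_snd.comp continuous_val
    refine (continuous_iff.2 ⟨h1, ?_⟩).prodMk (continuous_iff.2 ⟨h2, ?_⟩)
    · refine continuous_iff_continuousAt.2 fun p => ?_
      exact ENNReal.tendsto_of_tendsto_add (hN.eventually_lt h1.continuousAt)
        (hM.eventually_lt h2.continuousAt) continuous_apply.continuousAt p.2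
    · refine continuous_iff_continuousAt.2 fun p => ?_
      refine ENNReal.tendsto_of_tendsto_add (hM.eventually_lt h2.continuousAt)
        (hN.eventually_lt h1.continuousAt) ?_ (by rw [add_comm]; exact p.2)
      have := (continuous_apply (N := fun p : C × D => N p.1 + M p.2)).continuousAt (x := p)
      simpa only [ContinuousAt, add_comm] using this

/-- A Lelek norm: a lower semicontinuous function, finite on a dense set, such that near every
point it takes finite values in every interval above its value at that point. -/
structure IsLelek {C : Type*} [TopologicalSpace C] (N : C → ℝ≥0∞) : Prop where
  lsc : LowerSemicontinuous N
  exists_ne_top : ∀ U : Set C, IsOpen U → U.Nonempty → ∃ c ∈ U, N c ≠ ∞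
  exists_between : ∀ U : Set C, IsOpen U → ∀ c ∈ U, ∀ r s : ℝ≥0∞, N c ≤ r → r < s →
    ∃ d ∈ U, r < N d ∧ N d < s

theorem IsLelek.prod {C D : Type*} [TopologicalSpace C] [TopologicalSpace D]
    {N : C → ℝ≥0∞} {M : D → ℝ≥0∞} (hN : LowerSemicontinuous N)
    (hfin : ∀ U : Set C, IsOpen U → U.Nonempty → ∃ c ∈ U, N c ≠ ∞) (hM : IsLelek M) :
    IsLelek (fun p : C × D => N p.1 + M p.2) where
  lsc := (hN.comp continuous_fst).add (hM.lsc.comp continuous_snd)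
  exists_ne_top U hU := by
    rintro ⟨⟨c, d⟩, hcd⟩
    obtain ⟨V, W, hV, hW, hcV, hdW, hVW⟩ := isOpen_prod_iff.1 hU c d hcd
    obtain ⟨c', hc', hNc⟩ := hfin V hV ⟨c, hcV⟩
    obtain ⟨d', hd', hMd⟩ := hM.exists_ne_top W hW ⟨d, hdW⟩
    exact ⟨(c', d'), hVW ⟨hc', hd'⟩, by simpa using ⟨hNc, hMd⟩⟩
  exists_between U hU := by
    rintro ⟨c, d⟩ hcd r s hr hrs
    have hr' : r ≠ ∞ := hrs.ne_top
    have hNr : N c ≤ r := le_self_add.trans hr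
    have hNc : N c ≠ ∞ := ne_top_of_le_ne_top hr' hNr
    obtain ⟨d', hd', h1, h2⟩ := hM.exists_between ((fun d => (c, d)) ⁻¹' U)
      (hU.preimage (by fun_prop)) d hcd (r - N c) (s - N c)
      (ENNReal.le_sub_of_add_le_left hNc hr)
      ((ENNReal.sub_lt_iff_lt_right hNc hNr).2 (by rwa [tsub_add_cancel_of_le (hNr.trans hrs.le)]))
    refine ⟨(c, d'), hd', ?_, ?_⟩
    · simpa [add_comm] using ENNReal.sub_lt_iff_lt_right hNc hNr |>.1 h1
    · simpa [add_comm] using lt_tsub_iff_left.1 h2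

/-- The convergent sequence `{0} ∪ {1/m : m ≥ 1}` in the real line. -/
def HarmonicSeq : Set ℝ := {x | x = 0 ∨ ∃ m : ℕ, 0 < m ∧ x = 1 / (m : ℝ)}

theorem zero_mem_harmonicSeq : (0 : ℝ) ∈ HarmonicSeq := Or.inl rfl

theorem harmonicSeq_eq :
    HarmonicSeq = insert 0 (range fun m : ℕ => 1 / ((m : ℝ) + 1)) := by
  ext x
  constructor
  · rintro (h | ⟨m, hm, rfl⟩)
    · exact Or.inl h
    · refine Or.inr ⟨m - 1, ?_⟩
      have : ((m - 1 : ℕ) : ℝ) + 1 = m := by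
        exact_mod_cast Nat.succ_pred_eq_of_pos hm
      simp only [this]
  · rintro (h | ⟨m, rfl⟩)
    · exact Or.inl h
    · exact Or.inr ⟨m + 1, m.succ_pos, by push_cast; rfl⟩

instance : CompactSpace HarmonicSeq := by
  rw [← isCompact_iff_compactSpace, harmonicSeq_eq]
  exact tendsto_one_div_add_atTop_nhds_zero_nat.isCompact_insert_range

instance : TotallyDisconnectedSpace HarmonicSeq := by
  rw [totallyDisconnectedSpace_subtype_iff, harmonicSeq_eq]
  exact ((countable_range _).insert 0).isTotallyDisconnected

/-- The square of the `ℓ²`-norm, with value `∞` outside `ℓ²`. -/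
def sqNorm (x : ℕ → HarmonicSeq) : ℝ≥0∞ := ∑' n, ENNReal.ofReal ((x n : ℝ) ^ 2)

theorem lowerSemicontinuous_sqNorm : LowerSemicontinuous sqNorm :=
  lowerSemicontinuous_tsum fun n =>
    (ENNReal.continuous_ofReal.comp <| by fun_prop).lowerSemicontinuous

theorem sqNorm_eq_ofReal (x : lp (fun _ : ℕ => ℝ) 2) :
    ∑' n, ENNReal.ofReal ((x n) ^ 2) = ENNReal.ofReal (‖x‖ ^ 2) := by
  have h := lp.hasSum_norm (p := 2) (by simp) x
  simp only [ENNReal.toReal_ofNat, Real.rpow_ofNat, Real.norm_eq_abs, sq_abs] at h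
  rw [← h.tsum_eq, ENNReal.ofReal_tsum_of_nonneg (fun n => sq_nonneg _) h.summable]

theorem memℓp_of_sqNorm_ne_top {x : ℕ → HarmonicSeq} (hx : sqNorm x ≠ ∞) :
    Memℓp (fun n => (x n : ℝ)) 2 := by
  refine memℓp_gen ?_
  simp only [ENNReal.toReal_ofNat, Real.rpow_ofNat, Real.norm_eq_abs, sq_abs]
  have := ENNReal.summable_toReal hx
  refine this.congr fun n => ?_
  exact ENNReal.toReal_ofReal (sq_nonneg _)

/-- Complete Erdős space is the graph domain of the norm on the compact space of all sequences
with values in `{0} ∪ {1/m : m ≥ 1}`. -/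
def completeErdosHomeomorph : CompleteErdosSpace ≃ₜ GraphDomain sqNorm where
  toFun x := ⟨fun n => ⟨x.1 n, x.2 n⟩, by
    change ∑' n, ENNReal.ofReal ((x.1 n) ^ 2) ≠ ∞
    rw [sqNorm_eq_ofReal]
    exact ENNReal.ofReal_ne_top⟩
  invFun x := ⟨⟨fun n => (x.1 n : ℝ), memℓp_of_sqNorm_ne_top x.2⟩, fun n => (x.1 n).2⟩
  left_inv _ := rfl
  right_inv _ := rfl
  continuous_toFun := by
    have hval : Continuous fun x : CompleteErdosSpace => x.1 := continuous_subtype_val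
    refine GraphDomain.continuous_iff.2 ⟨?_, ?_⟩
    · refine continuous_pi fun n => Continuous.subtype_mk ?_ _
      exact ((lp.evalCLM ℝ (fun _ : ℕ => ℝ) 2 n).continuous).comp hval
    · change Continuous fun x : CompleteErdosSpace => ∑' n, ENNReal.ofReal ((x.1 n) ^ 2)
      simp only [sqNorm_eq_ofReal]
      exact ENNReal.continuous_ofReal.comp (hval.norm.pow 2)
  continuous_invFun := by
    refine Continuous.subtype_mk (continuous_iff_continuousAt.2 fun x => ?_) _
    set F : GraphDomain sqNorm → lp (fun _ : ℕ => ℝ) 2 :=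
      fun y => ⟨fun n => (y.1 n : ℝ), memℓp_of_sqNorm_ne_top y.2⟩ with hF
    change Tendsto F (𝓝 x) (𝓝 (F x))
    have hval := (GraphDomain.continuous_val (N := sqNorm)).tendsto x
    let f : (ℕ → HarmonicSeq) → ℝ≥0∞ := fun y => ∑' n, ENNReal.ofReal ((y n - x.1 n : ℝ) ^ 2)
    let g : (ℕ → HarmonicSeq) → ℝ≥0∞ := fun y => ∑' n, ENNReal.ofReal ((y n + x.1 n : ℝ) ^ 2)
    have hf : LowerSemicontinuous f :=
      lowerSemicontinuous_tsum fun n =>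
        (ENNReal.continuous_ofReal.comp <| by fun_prop).lowerSemicontinuous
    have hg : LowerSemicontinuous g :=
      lowerSemicontinuous_tsum fun n =>
        (ENNReal.continuous_ofReal.comp <| by fun_prop).lowerSemicontinuous
    have hfg : ∀ y, f y + g y = 2 * sqNorm y + 2 * sqNorm x.1 := fun y => by
      simp only [f, g, sqNorm]
      rw [← ENNReal.tsum_add, ← ENNReal.tsum_mul_left, ← ENNReal.tsum_mul_left, ← ENNReal.tsum_add]
      congr 1 with n : 1
      rw [← ENNReal.ofReal_add (by positivity) (by positivity),
        show (2 : ℝ≥0∞) = ENNReal.ofReal 2 by simp,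
        ← ENNReal.ofReal_mul (by norm_num), ← ENNReal.ofReal_mul (by norm_num),
        ← ENNReal.ofReal_add (by positivity) (by positivity)]
      congr 1
      ring
    have hfx : f x.1 = 0 := by simp [f]
    have key : Tendsto (fun y : GraphDomain sqNorm => f y.1) (𝓝 x) (𝓝 (f x.1)) := by
      refine ENNReal.tendsto_of_tendsto_add (hf.eventually_lt hval) (hg.eventually_lt hval) ?_ ?_
      · simp only [hfg]
        exact ((ENNReal.continuous_const_mul (by simp)).comp
          GraphDomain.continuous_apply).tendsto x |>.add tendsto_const_nhds
      · rw [hfg]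
        exact ENNReal.add_ne_top.2 ⟨ENNReal.mul_ne_top (by simp) x.2,
          ENNReal.mul_ne_top (by simp) x.2⟩
    have hfF : ∀ y : GraphDomain sqNorm, f y.1 = ENNReal.ofReal (‖F y - F x‖ ^ 2) := fun y => by
      rw [← sqNorm_eq_ofReal]
      rfl
    rw [hfx] at key
    simp only [hfF] at key
    have key2 := (ENNReal.tendsto_toReal ENNReal.zero_ne_top).comp key
    have key3 : Tendsto (fun y => ‖F y - F x‖ ^ 2) (𝓝 x) (𝓝 0) := by
      refine key2.congr fun y => ?_
      exact ENNReal.toReal_ofReal (sq_nonneg _)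
    rw [tendsto_iff_norm_sub_tendsto_zero]
    have key4 := key3.sqrt
    simpa [Real.sqrt_sq (norm_nonneg _)] using key4

/-- The sequence agreeing with `x` before `k`, equal to `1/m` on `[k, k + j)` and to `0` later. -/
def patchSeq (x : ℕ → HarmonicSeq) (k j m : ℕ) : ℕ → HarmonicSeq := fun n =>
  if n < k then x n else if n < k + j then ⟨1 / ((m : ℝ) + 1), Or.inr ⟨m + 1, m.succ_pos, by simp⟩⟩
  else ⟨0, zero_mem_harmonicSeq⟩

theorem sqNorm_patchSeq (x : ℕ → HarmonicSeq) (k j m : ℕ) :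
    sqNorm (patchSeq x k j m) = ∑ n ∈ Finset.range k, ENNReal.ofReal ((x n : ℝ) ^ 2) +
      j * ENNReal.ofReal ((1 / ((m : ℝ) + 1)) ^ 2) := by
  have h0 : ∀ n ∉ Finset.range (k + j), ENNReal.ofReal ((patchSeq x k j m n : ℝ) ^ 2) = 0 := by
    intro n hn
    have : ¬ n < k + j := by simpa using hn
    simp [patchSeq, this, show ¬ n < k by omega]
  rw [sqNorm, tsum_eq_sum h0, Finset.sum_range_add]
  congr 1
  · refine Finset.sum_congr rfl fun n hn => ?_
    simp [patchSeq, Finset.mem_range.1 hn]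
  · rw [Finset.sum_congr rfl (g := fun _ => ENNReal.ofReal ((1 / ((m : ℝ) + 1)) ^ 2))]
    · simp
    · intro n hn
      simp [patchSeq, Finset.mem_range.1 hn]

theorem exists_patchSeq_mem {U : Set (ℕ → HarmonicSeq)} (hU : IsOpen U) {x : ℕ → HarmonicSeq}
    (hx : x ∈ U) : ∃ k, ∀ j m, patchSeq x k j m ∈ U := by
  obtain ⟨I, u, hu, hIU⟩ := isOpen_pi_iff.1 hU x hx
  refine ⟨I.sup id + 1, fun j m => hIU fun n hn => ?_⟩
  have : n < I.sup id + 1 := Nat.lt_succ_of_le (Finset.le_sup (f := id) hn)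
  simpa [patchSeq, this] using (hu n hn).2

theorem isLelek_sqNorm : IsLelek sqNorm where
  lsc := lowerSemicontinuous_sqNorm
  exists_ne_top U hU := by
    rintro ⟨x, hx⟩
    obtain ⟨k, hk⟩ := exists_patchSeq_mem hU hx
    refine ⟨_, hk 0 0, ?_⟩
    rw [sqNorm_patchSeq]
    simp
  exists_between U hU x hx r s hr hrs := by
    obtain ⟨k, hk⟩ := exists_patchSeq_mem hU hx
    obtain ⟨s', hrs', hs's⟩ := exists_between hrs
    lift s' to NNReal using hs's.ne_top
    lift r to NNReal using hrs.ne_top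
    have hrs'' : (r : ℝ) < s' := by exact_mod_cast hrs'
    set H : ℝ := ∑ n ∈ Finset.range k, (x n : ℝ) ^ 2 with hH
    have hH0 : 0 ≤ H := Finset.sum_nonneg fun _ _ => sq_nonneg _
    have hHr : H ≤ r := by
      have h1 : ENNReal.ofReal H ≤ r := by
        rw [hH, ENNReal.ofReal_sum_of_nonneg fun _ _ => sq_nonneg _]
        exact (ENNReal.sum_le_tsum _).trans hr
      simpa [ENNReal.ofReal_le_iff_le_toReal] using h1
    obtain ⟨m, hm⟩ := exists_nat_one_div_lt (sub_pos.2 hrs'')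
    set δ : ℝ := (1 / ((m : ℝ) + 1)) ^ 2 with hδ
    have hδ0 : 0 < δ := by positivity
    have hδs : δ < s' - r := by
      refine lt_of_le_of_lt ?_ hm
      have h1 : 1 / ((m : ℝ) + 1) ≤ 1 := by
        rw [div_le_one (by positivity)]
        linarith [Nat.cast_nonneg (α := ℝ) m]
      have h0 : 0 ≤ 1 / ((m : ℝ) + 1) := by positivity
      nlinarith
    set j : ℕ := ⌊(r - H) / δ⌋₊ + 1 with hj
    have hj1 : (r - H) / δ < j := by exact_mod_cast Nat.lt_floor_add_one _
    have hj2 : (j : ℝ) - 1 ≤ (r - H) / δ := by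
      have := Nat.floor_le (div_nonneg (sub_nonneg.2 hHr) hδ0.le)
      simpa [hj] using this
    rw [div_lt_iff₀ hδ0] at hj1
    rw [le_div_iff₀ hδ0] at hj2
    have hval : sqNorm (patchSeq x k j m) = ENNReal.ofReal (H + j * δ) := by
      rw [sqNorm_patchSeq, ENNReal.ofReal_add hH0 (by positivity), hH,
        ENNReal.ofReal_sum_of_nonneg fun _ _ => sq_nonneg _, ENNReal.ofReal_mul (by positivity)]
      rw [ENNReal.ofReal_natCast]
    refine ⟨_, hk j m, ?_, ?_⟩
    · rw [hval, ENNReal.lt_ofReal_iff_toReal_lt ENNReal.coe_ne_top]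
      simp only [ENNReal.coe_toReal]
      linarith
    · refine lt_of_le_of_lt ?_ hs's
      rw [hval]
      refine ENNReal.ofReal_le_of_le_toReal ?_
      simp only [ENNReal.coe_toReal]
      linarith

/-- The infimum of `N` over a set. -/
def infOn {C : Type*} (N : C → ℝ≥0∞) (U : Set C) : ℝ≥0∞ := ⨅ c ∈ U, N c

section Infimum

variable {C : Type*} {N : C → ℝ≥0∞}

theorem infOn_le {U : Set C} {c : C} (hc : c ∈ U) : infOn N U ≤ N c := iInf₂_le c hc

theorem infOn_anti {U V : Set C} (h : U ⊆ V) : infOn N V ≤ infOn N U := iInf_le_iInf_of_subset h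

theorem infOn_union (U V : Set C) : infOn N (U ∪ V) = min (infOn N U) (infOn N V) := iInf_union

theorem infOn_empty : infOn N ∅ = ∞ := by simp [infOn]

theorem exists_lt_of_infOn_lt {U : Set C} {r : ℝ≥0∞} (h : infOn N U < r) : ∃ c ∈ U, N c < r := by
  simpa [infOn, iInf_lt_iff] using h

variable [TopologicalSpace C]

theorem IsLelek.infOn_ne_top (hN : IsLelek N) {U : Set C} (hU : IsOpen U) (hne : U.Nonempty) :
    infOn N U ≠ ∞ := by
  obtain ⟨c, hc, h⟩ := hN.exists_ne_top U hU hne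
  exact ne_top_of_le_ne_top h (infOn_le hc)

variable [CompactSpace C] [T2Space C] [TotallyDisconnectedSpace C]

/-- A clopen set splits into two clopen sets, one with the same infimum and the other with an
infimum close to a prescribed larger value. -/
theorem IsLelek.exists_split (hN : IsLelek N) {V : Set C} (hV : IsClopen V) {b ε : ℝ≥0∞}
    (hVb : infOn N V ≤ b) (hb : b ≠ ∞) (hε : 0 < ε) (hε' : ε ≠ ∞) :
    ∃ W ⊆ V, IsClopen W ∧ W.Nonempty ∧ (V \ W).Nonempty ∧ infOn N (V \ W) = infOn N V ∧
      b ≤ infOn N W ∧ infOn N W ≤ b + ε := by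
  have hε2 : ε / 2 ≠ 0 := by simpa using hε.ne'
  have hbr : b < b + ε / 2 := ENNReal.lt_add_right hb hε2
  have hrs : b + ε / 2 < b + ε :=
    (ENNReal.add_lt_add_iff_left hb).2 (ENNReal.half_lt_self hε.ne' hε')
  obtain ⟨c, hcV, hc⟩ := exists_lt_of_infOn_lt (hVb.trans_lt hbr)
  obtain ⟨d, hdV, hd1, hd2⟩ := hN.exists_between V hV.isOpen c hcV _ _ hc.le hrs
  obtain ⟨W, hW, hdW, hWV⟩ := compact_exists_isClopen_in_isOpen
    (hV.isOpen.inter (hN.lsc.isOpen_preimage (b + ε / 2))) ⟨hdV, hd1⟩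
  have hWinf : b + ε / 2 ≤ infOn N W := le_iInf₂ fun x hx => (hWV hx).2.le
  have hWsub : W ⊆ V := fun x hx => (hWV hx).1
  have hrest : infOn N (V \ W) = infOn N V := by
    have h := infOn_union (N := N) W (V \ W)
    rw [union_sdiff_cancel hWsub] at h
    rcases min_choice (infOn N W) (infOn N (V \ W)) with h' | h'
    · rw [h'] at h
      exact absurd (h ▸ hWinf) (not_le.2 (hVb.trans_lt hbr))
    · rw [h, h']
  refine ⟨W, hWsub, hW, ⟨d, hdW⟩, ?_, hrest, hbr.le.trans hWinf, (infOn_le hdW).trans hd2.le⟩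
  rw [nonempty_iff_ne_empty]
  intro h0
  rw [h0, infOn_empty] at hrest
  exact hb (top_le_iff.1 (hrest ▸ hVb))

theorem LowerSemicontinuous.tendsto_infOn (hN : LowerSemicontinuous N) {W : ℕ → Set C}
    (hW : Antitone W) {c : C} (hc : ∀ n, c ∈ W n)
    (hsmall : ∀ G : Set C, IsClopen G → c ∈ G → ∃ n, W n ⊆ G) :
    Tendsto (fun n => infOn N (W n)) atTop (𝓝 (N c)) := by
  refine tendsto_order.2 ⟨fun r hr => ?_, fun r hr =>
    Eventually.of_forall fun n => (infOn_le (hc n)).trans_lt hr⟩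
  obtain ⟨s, hrs, hs⟩ := exists_between hr
  obtain ⟨G, hG, hcG, hGs⟩ := compact_exists_isClopen_in_isOpen (hN.isOpen_preimage s) hs
  obtain ⟨n, hn⟩ := hsmall G hG hcG
  filter_upwards [eventually_ge_atTop n] with k hk
  exact hrs.trans_le (le_iInf₂ fun x hx => (hGs (hn (hW hk hx))).le)

end Infimum

/-- A set of pairs of nonempty clopen sets whose first components partition `A` and whose second
components partition `B`. -/
structure IsMatching {C D : Type*} [TopologicalSpace C] [TopologicalSpace D]
    (A : Set C) (B : Set D) (P : Set (Set C × Set D)) : Prop where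
  clopen_fst : ∀ p ∈ P, IsClopen p.1
  clopen_snd : ∀ p ∈ P, IsClopen p.2
  nonempty_fst : ∀ p ∈ P, p.1.Nonempty
  nonempty_snd : ∀ p ∈ P, p.2.Nonempty
  mem_fst_iff : ∀ c, c ∈ A ↔ ∃ p ∈ P, c ∈ p.1
  mem_snd_iff : ∀ d, d ∈ B ↔ ∃ p ∈ P, d ∈ p.2
  eq_of_mem_fst : ∀ p ∈ P, ∀ q ∈ P, ∀ c ∈ p.1, c ∈ q.1 → p = q
  eq_of_mem_snd : ∀ p ∈ P, ∀ q ∈ P, ∀ d ∈ p.2, d ∈ q.2 → p = q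

/-- The difference between the infima over the two components of a pair. -/
def gap {C D : Type*} (N : C → ℝ≥0∞) (M : D → ℝ≥0∞) (p : Set C × Set D) : ℝ :=
  (infOn M p.2).toReal - (infOn N p.1).toReal

section Gap

variable {C D : Type*} {N : C → ℝ≥0∞} {M : D → ℝ≥0∞} {P : Set (Set C × Set D)}

theorem gap_swap (p : Set C × Set D) : gap M N p.swap = -gap N M p := by
  simp [gap]

/-- `Q` refines `P` with gaps changing by at most `ε`. -/
def GapRefines (N : C → ℝ≥0∞) (M : D → ℝ≥0∞) (ε : ℝ) (Q P : Set (Set C × Set D)) : Prop :=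
  ∀ q ∈ Q, ∃ p ∈ P, q.1 ⊆ p.1 ∧ q.2 ⊆ p.2 ∧ |gap N M q - gap N M p| ≤ ε

theorem GapRefines.trans {Q R : Set (Set C × Set D)} {ε δ : ℝ} (h₁ : GapRefines N M ε R Q)
    (h₂ : GapRefines N M δ Q P) : GapRefines N M (ε + δ) R P := by
  intro r hr
  obtain ⟨q, hq, h1, h2, h3⟩ := h₁ r hr
  obtain ⟨p, hp, h4, h5, h6⟩ := h₂ q hq
  exact ⟨p, hp, h1.trans h4, h2.trans h5, (abs_sub_le _ _ _).trans (add_le_add h3 h6)⟩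

theorem GapRefines.swap {Q : Set (Set C × Set D)} {ε : ℝ} (h : GapRefines N M ε Q P) :
    GapRefines M N ε (Prod.swap ⁻¹' Q) (Prod.swap ⁻¹' P) := by
  intro q hq
  obtain ⟨p, hp, h1, h2, h3⟩ := h _ hq
  refine ⟨p.swap, by simpa using hp, h2, h1, ?_⟩
  rwa [gap_swap, ← q.swap_swap, gap_swap q.swap, neg_sub_neg, abs_sub_comm]

end Gap

section Matching

variable {C D : Type*} [TopologicalSpace C] [TopologicalSpace D]
  {N : C → ℝ≥0∞} {M : D → ℝ≥0∞} {A : Set C} {B : Set D} {P : Set (Set C × Set D)}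

theorem IsMatching.singleton (hA : IsClopen A) (hB : IsClopen B) (hA' : A.Nonempty)
    (hB' : B.Nonempty) : IsMatching A B {(A, B)} := by
  constructor <;> simp_all

theorem IsMatching.swap (h : IsMatching A B P) : IsMatching B A (Prod.swap ⁻¹' P) where
  clopen_fst p hp := h.clopen_snd _ hp
  clopen_snd p hp := h.clopen_fst _ hp
  nonempty_fst p hp := h.nonempty_snd _ hp
  nonempty_snd p hp := h.nonempty_fst _ hp
  mem_fst_iff d := (h.mem_snd_iff d).trans
    ⟨fun ⟨p, hp, hd⟩ => ⟨p.swap, by simpa using hp, hd⟩, fun ⟨p, hp, hd⟩ => ⟨p.swap, hp, hd⟩⟩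
  mem_snd_iff c := (h.mem_fst_iff c).trans
    ⟨fun ⟨p, hp, hc⟩ => ⟨p.swap, by simpa using hp, hc⟩, fun ⟨p, hp, hc⟩ => ⟨p.swap, hp, hc⟩⟩
  eq_of_mem_fst p hp q hq c hc hc' :=
    Prod.swap_injective (h.eq_of_mem_snd _ hp _ hq c hc hc')
  eq_of_mem_snd p hp q hq c hc hc' :=
    Prod.swap_injective (h.eq_of_mem_fst _ hp _ hq c hc hc')

theorem IsMatching.bind (h : IsMatching A B P) {Q : Set C × Set D → Set (Set C × Set D)}
    (hQ : ∀ p ∈ P, IsMatching p.1 p.2 (Q p)) : IsMatching A B (⋃ p ∈ P, Q p) := by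
  constructor
  · simp only [mem_iUnion]
    rintro q ⟨p, hp, hq⟩
    exact (hQ p hp).clopen_fst q hq
  · simp only [mem_iUnion]
    rintro q ⟨p, hp, hq⟩
    exact (hQ p hp).clopen_snd q hq
  · simp only [mem_iUnion]
    rintro q ⟨p, hp, hq⟩
    exact (hQ p hp).nonempty_fst q hq
  · simp only [mem_iUnion]
    rintro q ⟨p, hp, hq⟩
    exact (hQ p hp).nonempty_snd q hq
  · intro c
    rw [h.mem_fst_iff]
    simp only [mem_iUnion]
    constructor
    · rintro ⟨p, hp, hc⟩
      obtain ⟨q, hq, hcq⟩ := ((hQ p hp).mem_fst_iff c).1 hc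
      exact ⟨q, ⟨p, hp, hq⟩, hcq⟩
    · rintro ⟨q, ⟨p, hp, hq⟩, hcq⟩
      exact ⟨p, hp, ((hQ p hp).mem_fst_iff c).2 ⟨q, hq, hcq⟩⟩
  · intro c
    rw [h.mem_snd_iff]
    simp only [mem_iUnion]
    constructor
    · rintro ⟨p, hp, hc⟩
      obtain ⟨q, hq, hcq⟩ := ((hQ p hp).mem_snd_iff c).1 hc
      exact ⟨q, ⟨p, hp, hq⟩, hcq⟩
    · rintro ⟨q, ⟨p, hp, hq⟩, hcq⟩
      exact ⟨p, hp, ((hQ p hp).mem_snd_iff c).2 ⟨q, hq, hcq⟩⟩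
  · simp only [mem_iUnion]
    rintro q ⟨p, hp, hq⟩ q' ⟨p', hp', hq'⟩ c hc hc'
    obtain rfl := h.eq_of_mem_fst p hp p' hp' c (((hQ p hp).mem_fst_iff c).2 ⟨q, hq, hc⟩)
      (((hQ p' hp').mem_fst_iff c).2 ⟨q', hq', hc'⟩)
    exact (hQ p hp).eq_of_mem_fst q hq q' hq' c hc hc'
  · simp only [mem_iUnion]
    rintro q ⟨p, hp, hq⟩ q' ⟨p', hp', hq'⟩ c hc hc'
    obtain rfl := h.eq_of_mem_snd p hp p' hp' c (((hQ p hp).mem_snd_iff c).2 ⟨q, hq, hc⟩)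
      (((hQ p' hp').mem_snd_iff c).2 ⟨q', hq', hc'⟩)
    exact (hQ p hp).eq_of_mem_snd q hq q' hq' c hc hc'

variable [CompactSpace D] [T2Space D] [TotallyDisconnectedSpace D]

theorem exists_matching_pair (hN : IsLelek N) (hM : IsLelek M) {U₁ U₂ : Set C} {V : Set D}
    (hU₁ : IsClopen U₁) (hU₂ : IsClopen U₂) (hne₁ : U₁.Nonempty) (hne₂ : U₂.Nonempty)
    (hdisj : Disjoint U₁ U₂) (hle : infOn N U₁ ≤ infOn N U₂) (hV : IsClopen V)
    (hVne : V.Nonempty) {ε : ℝ} (hε : 0 < ε) :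
    ∃ Q, IsMatching (U₁ ∪ U₂) V Q ∧ ∀ q ∈ Q,
      |gap N M q - gap N M (U₁ ∪ U₂, V)| ≤ ε ∧ (q.1 = U₁ ∨ q.1 = U₂) := by
  have h1 := hN.infOn_ne_top hU₁.isOpen hne₁
  have h2 := hN.infOn_ne_top hU₂.isOpen hne₂
  have hv := hM.infOn_ne_top hV.isOpen hVne
  have hb : infOn M V + (infOn N U₂ - infOn N U₁) ≠ ∞ :=
    ENNReal.add_ne_top.2 ⟨hv, ENNReal.sub_ne_top h2⟩
  obtain ⟨W, hWV, hW, hWne, hRne, hR, hW1, hW2⟩ := hM.exists_split hV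
    (b := infOn M V + (infOn N U₂ - infOn N U₁)) (ε := ENNReal.ofReal ε)
    le_self_add hb (by simpa using hε) ENNReal.ofReal_ne_top
  have hw := hM.infOn_ne_top hW.isOpen hWne
  have hW1' := ENNReal.toReal_mono hw hW1
  have hW2' := ENNReal.toReal_mono (ENNReal.add_ne_top.2 ⟨hb, ENNReal.ofReal_ne_top⟩) hW2
  rw [ENNReal.toReal_add hb ENNReal.ofReal_ne_top, ENNReal.toReal_ofReal hε.le] at hW2'
  rw [ENNReal.toReal_add hv (ENNReal.sub_ne_top h2), ENNReal.toReal_sub_of_le hle h2]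
    at hW1' hW2'
  have hU : infOn N (U₁ ∪ U₂) = infOn N U₁ := by rw [infOn_union, min_eq_left hle]
  refine ⟨{(U₁, V \ W), (U₂, W)}, ?_, ?_⟩
  · have hdisj' := disjoint_left.1 hdisj
    constructor
    · rintro p (rfl | rfl)
      exacts [hU₁, hU₂]
    · rintro p (rfl | rfl)
      exacts [hV.diff hW, hW]
    · rintro p (rfl | rfl)
      exacts [hne₁, hne₂]
    · rintro p (rfl | rfl)
      exacts [hRne, hWne]
    · simp
    · intro d
      simp only [mem_insert_iff, mem_singleton_iff, exists_eq_or_imp, exists_eq_left, Set.mem_sdiff]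
      have := @hWV d
      tauto
    · rintro p (rfl | rfl) q (rfl | rfl) c hc hc'
      exacts [rfl, absurd hc' (hdisj' hc), absurd hc (hdisj' hc'), rfl]
    · rintro p (rfl | rfl) q (rfl | rfl) c hc hc'
      exacts [rfl, absurd hc' hc.2, absurd hc hc'.2, rfl]
  · rintro q (rfl | rfl)
    · refine ⟨?_, Or.inl rfl⟩
      simp only [gap, hU, hR, sub_self, abs_zero]
      exact hε.le
    · refine ⟨?_, Or.inr rfl⟩
      simp only [gap, hU]
      rw [abs_le]
      constructor <;> linarith

theorem exists_matching_subset_or_disjoint (hN : IsLelek N) (hM : IsLelek M) {U : Set C}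
    {V : Set D} (hU : IsClopen U) (hUne : U.Nonempty) (hV : IsClopen V) (hVne : V.Nonempty)
    {G : Set C} (hG : IsClopen G) {ε : ℝ} (hε : 0 < ε) :
    ∃ Q, IsMatching U V Q ∧ ∀ q ∈ Q,
      |gap N M q - gap N M (U, V)| ≤ ε ∧ (q.1 ⊆ G ∨ Disjoint q.1 G) := by
  by_cases h1 : (U ∩ G).Nonempty
  · by_cases h2 : (U \ G).Nonempty
    · have hd : Disjoint (U ∩ G) (U \ G) :=
        disjoint_left.2 fun x hx hx' => hx'.2 hx.2
      rcases le_total (infOn N (U ∩ G)) (infOn N (U \ G)) with hle | hle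
      · obtain ⟨Q, hQ, hQ'⟩ := exists_matching_pair hN hM (hU.inter hG) (hU.diff hG) h1 h2 hd hle
          hV hVne hε
        rw [inter_union_sdiff] at hQ hQ'
        refine ⟨Q, hQ, fun q hq => ⟨(hQ' q hq).1, ?_⟩⟩
        rcases (hQ' q hq).2 with h | h
        · exact Or.inl (h ▸ inter_subset_right)
        · exact Or.inr (h ▸ disjoint_sdiff_left)
      · obtain ⟨Q, hQ, hQ'⟩ := exists_matching_pair hN hM (hU.diff hG) (hU.inter hG) h2 h1
          hd.symm hle hV hVne hε
        rw [sdiff_union_inter] at hQ hQ'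
        refine ⟨Q, hQ, fun q hq => ⟨(hQ' q hq).1, ?_⟩⟩
        rcases (hQ' q hq).2 with h | h
        · exact Or.inr (h ▸ disjoint_sdiff_left)
        · exact Or.inl (h ▸ inter_subset_right)
    · refine ⟨_, .singleton hU hV hUne hVne, ?_⟩
      rintro q rfl
      exact ⟨by simpa using hε.le, Or.inl (sdiff_eq_empty.1 (not_nonempty_iff_eq_empty.1 h2))⟩
  · refine ⟨_, .singleton hU hV hUne hVne, ?_⟩
    rintro q rfl
    exact ⟨by simpa using hε.le,
      Or.inr (disjoint_iff_inter_eq_empty.2 (not_nonempty_iff_eq_empty.1 h1))⟩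

theorem IsMatching.exists_refine_fst (hN : IsLelek N) (hM : IsLelek M)
    (hP : IsMatching A B P) {G : Set C} (hG : IsClopen G) {ε : ℝ} (hε : 0 < ε) :
    ∃ Q, IsMatching A B Q ∧ GapRefines N M ε Q P ∧ ∀ q ∈ Q, q.1 ⊆ G ∨ Disjoint q.1 G := by
  have h : ∀ p : Set C × Set D, ∃ Q : Set (Set C × Set D), p ∈ P → IsMatching p.1 p.2 Q ∧
      ∀ q ∈ Q, |gap N M q - gap N M p| ≤ ε ∧ (q.1 ⊆ G ∨ Disjoint q.1 G) := by
    intro p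
    by_cases hp : p ∈ P
    · obtain ⟨Q, hQ⟩ := exists_matching_subset_or_disjoint hN hM (hP.clopen_fst p hp)
        (hP.nonempty_fst p hp) (hP.clopen_snd p hp) (hP.nonempty_snd p hp) hG hε
      exact ⟨Q, fun _ => hQ⟩
    · exact ⟨∅, fun h => absurd h hp⟩
  choose Q hQ using h
  refine ⟨⋃ p ∈ P, Q p, hP.bind fun p hp => (hQ p hp).1, ?_, ?_⟩
  · intro q hq
    simp only [mem_iUnion] at hq
    obtain ⟨p, hp, hq⟩ := hq
    exact ⟨p, hp, fun c hc => ((hQ p hp).1.mem_fst_iff c).2 ⟨q, hq, hc⟩,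
      fun c hc => ((hQ p hp).1.mem_snd_iff c).2 ⟨q, hq, hc⟩, ((hQ p hp).2 q hq).1⟩
  · intro q hq
    simp only [mem_iUnion] at hq
    obtain ⟨p, hp, hq⟩ := hq
    exact ((hQ p hp).2 q hq).2

end Matching

section MatchingSequence

variable {C D : Type*} [TopologicalSpace C] [TopologicalSpace D]
  {N : C → ℝ≥0∞} {M : D → ℝ≥0∞} {A : Set C} {B : Set D} {P : Set (Set C × Set D)}

/-- Increasingly fine matchings of `C` and `D` whose gaps converge uniformly. -/
structure IsMatchingSeq (N : C → ℝ≥0∞) (M : D → ℝ≥0∞) (P : ℕ → Set (Set C × Set D)) : Prop where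
  matching : ∀ n, IsMatching univ univ (P n)
  refines : ∀ n, GapRefines N M ((1 / 2) ^ n) (P (n + 1)) (P n)
  fine_fst : ∀ G, IsClopen G → ∃ n, ∀ p ∈ P n, p.1 ⊆ G ∨ Disjoint p.1 G
  fine_snd : ∀ H, IsClopen H → ∃ n, ∀ p ∈ P n, p.2 ⊆ H ∨ Disjoint p.2 H

theorem IsMatchingSeq.swap {P : ℕ → Set (Set C × Set D)} (h : IsMatchingSeq N M P) :
    IsMatchingSeq M N (fun n => Prod.swap ⁻¹' (P n)) where
  matching n := (h.matching n).swap
  refines n := (h.refines n).swap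
  fine_fst H hH := (h.fine_snd H hH).imp fun _ hn _ hp => hn _ hp
  fine_snd G hG := (h.fine_fst G hG).imp fun _ hn _ hp => hn _ hp

section Existence

variable [CompactSpace C] [T2Space C] [TotallyDisconnectedSpace C]

theorem IsMatching.exists_refine_snd (hN : IsLelek N) (hM : IsLelek M)
    (hP : IsMatching A B P) {H : Set D} (hH : IsClopen H) {ε : ℝ} (hε : 0 < ε) :
    ∃ Q, IsMatching A B Q ∧ GapRefines N M ε Q P ∧ ∀ q ∈ Q, q.2 ⊆ H ∨ Disjoint q.2 H := by
  obtain ⟨Q, hQ, hQ1, hQ2⟩ := hP.swap.exists_refine_fst hM hN hH hε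
  exact ⟨_, hQ.swap, hQ1.swap, fun q hq => hQ2 _ hq⟩

variable [CompactSpace D] [T2Space D] [TotallyDisconnectedSpace D]

theorem IsMatching.exists_refine (hN : IsLelek N) (hM : IsLelek M)
    (hP : IsMatching A B P) {G : Set C} (hG : IsClopen G) {H : Set D} (hH : IsClopen H)
    {ε : ℝ} (hε : 0 < ε) :
    ∃ Q, IsMatching A B Q ∧ GapRefines N M ε Q P ∧ (∀ q ∈ Q, q.1 ⊆ G ∨ Disjoint q.1 G) ∧
      ∀ q ∈ Q, q.2 ⊆ H ∨ Disjoint q.2 H := by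
  obtain ⟨Q, hQ, hQP, hQG⟩ := hP.exists_refine_fst hN hM hG (half_pos hε)
  obtain ⟨R, hR, hRQ, hRH⟩ := hQ.exists_refine_snd hN hM hH (half_pos hε)
  refine ⟨R, hR, by simpa using hRQ.trans hQP, fun r hr => ?_, hRH⟩
  obtain ⟨q, hq, h1, -, -⟩ := hRQ r hr
  exact (hQG q hq).imp h1.trans (Disjoint.mono_left h1)

theorem exists_isMatchingSeq [SecondCountableTopology C] [SecondCountableTopology D] [Nonempty C]
    [Nonempty D] (hN : IsLelek N) (hM : IsLelek M) : ∃ P, IsMatchingSeq N M P := by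
  have hC : Countable (TopologicalSpace.Clopens C) :=
    TopologicalSpace.Clopens.countable_iff_secondCountable.2 inferInstance
  have hD : Countable (TopologicalSpace.Clopens D) :=
    TopologicalSpace.Clopens.countable_iff_secondCountable.2 inferInstance
  obtain ⟨G, hG⟩ := exists_surjective_nat (TopologicalSpace.Clopens C)
  obtain ⟨H, hH⟩ := exists_surjective_nat (TopologicalSpace.Clopens D)
  have step : ∀ (n : ℕ) (P : {P : Set (Set C × Set D) // IsMatching univ univ P}),
      ∃ Q : {P : Set (Set C × Set D) // IsMatching univ univ P},
        GapRefines N M ((1 / 2) ^ n) Q.1 P.1 ∧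
        (∀ q ∈ Q.1, q.1 ⊆ (G n : Set C) ∨ Disjoint q.1 (G n : Set C)) ∧
        ∀ q ∈ Q.1, q.2 ⊆ (H n : Set D) ∨ Disjoint q.2 (H n : Set D) := by
    intro n P
    obtain ⟨Q, hQ, h⟩ := P.2.exists_refine hN hM (G n).isClopen (H n).isClopen
      (ε := (1 / 2) ^ n) (by positivity)
    exact ⟨⟨Q, hQ⟩, h⟩
  choose next hnext using step
  let P : ℕ → {P : Set (Set C × Set D) // IsMatching univ univ P} := fun n =>
    Nat.rec ⟨_, .singleton isClopen_univ isClopen_univ univ_nonempty univ_nonempty⟩ next n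
  refine ⟨fun n => (P n).1, fun n => (P n).2, fun n => (hnext n (P n)).1, fun U hU => ?_,
    fun V hV => ?_⟩
  · obtain ⟨n, hn⟩ := hG ⟨U, hU⟩
    exact ⟨n + 1, by simpa [hn] using (hnext n (P n)).2.1⟩
  · obtain ⟨n, hn⟩ := hH ⟨V, hV⟩
    exact ⟨n + 1, by simpa [hn] using (hnext n (P n)).2.2⟩

end Existence

namespace IsMatchingSeq

variable {P : ℕ → Set (Set C × Set D)}

/-- Points of `C` and `D` lying in matched cells at every stage. -/
def Related (P : ℕ → Set (Set C × Set D)) (c : C) (d : D) : Prop :=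
  ∀ n, ∃ p ∈ P n, c ∈ p.1 ∧ d ∈ p.2

variable [CompactSpace C] [T2Space C] [TotallyDisconnectedSpace C]
  [CompactSpace D] [T2Space D] [TotallyDisconnectedSpace D]

theorem exists_map (h : IsMatchingSeq N M P) (hN : IsLelek N) (hM : IsLelek M) :
    ∃ f : C → D, Continuous f ∧ (∀ c d, Related P c d ↔ d = f c) ∧
      ∃ β : C → ℝ, Continuous β ∧
        ∀ c, N c ≠ ∞ → M (f c) = ENNReal.ofReal ((N c).toReal + β c) := by
  have hcell : ∀ n c, ∃ p ∈ P n, c ∈ p.1 := fun n c =>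
    ((h.matching n).mem_fst_iff c).1 (mem_univ c)
  choose cell hcP hcm using hcell
  have huniq : ∀ n c, ∀ p ∈ P n, c ∈ p.1 → p = cell n c := fun n c p hp hc =>
    (h.matching n).eq_of_mem_fst p hp _ (hcP n c) c hc (hcm n c)
  have hstep : ∀ n c, (cell (n + 1) c).1 ⊆ (cell n c).1 ∧ (cell (n + 1) c).2 ⊆ (cell n c).2 ∧
      |gap N M (cell (n + 1) c) - gap N M (cell n c)| ≤ (1 / 2) ^ n := by
    intro n c
    obtain ⟨p, hp, h1, h2, h3⟩ := h.refines n _ (hcP (n + 1) c)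
    obtain rfl := huniq n c p hp (h1 (hcm _ _))
    exact ⟨h1, h2, h3⟩
  have hanti1 : ∀ c, Antitone fun n => (cell n c).1 := fun c =>
    antitone_nat_of_succ_le fun n => (hstep n c).1
  have hanti2 : ∀ c, Antitone fun n => (cell n c).2 := fun c =>
    antitone_nat_of_succ_le fun n => (hstep n c).2.1
  have hne : ∀ c, (⋂ n, (cell n c).2).Nonempty := fun c =>
    IsCompact.nonempty_iInter_of_directed_nonempty_isCompact_isClosed _
      (hanti2 c).directed_ge (fun n => (h.matching n).nonempty_snd _ (hcP n c))
      (fun n => ((h.matching n).clopen_snd _ (hcP n c)).isClosed.isCompact)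
      (fun n => ((h.matching n).clopen_snd _ (hcP n c)).isClosed)
  choose f hf using hne
  simp only [mem_iInter] at hf
  have hfine1 : ∀ c (G : Set C), IsClopen G → c ∈ G → ∃ n, (cell n c).1 ⊆ G := by
    intro c G hG hc
    obtain ⟨n, hn⟩ := h.fine_fst G hG
    exact ⟨n, (hn _ (hcP n c)).resolve_right fun hd => disjoint_left.1 hd (hcm n c) hc⟩
  have hfine2 : ∀ c (H : Set D), IsClopen H → f c ∈ H → ∃ n, (cell n c).2 ⊆ H := by
    intro c H hH hc
    obtain ⟨n, hn⟩ := h.fine_snd H hH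
    exact ⟨n, (hn _ (hcP n c)).resolve_right fun hd => disjoint_left.1 hd (hf c n) hc⟩
  have hloc : ∀ n c, ∀ᶠ c' in 𝓝 c, cell n c' = cell n c := by
    intro n c
    filter_upwards [((h.matching n).clopen_fst _ (hcP n c)).isOpen.mem_nhds (hcm n c)] with c' hc'
    exact (huniq n c' _ (hcP n c) hc').symm
  refine ⟨f, ?_, ?_, ?_⟩
  · refine (isTopologicalBasis_isClopen (X := D)).continuous_iff.2 fun H hH => ?_
    refine isOpen_iff_mem_nhds.2 fun c hc => ?_
    obtain ⟨n, hn⟩ := hfine2 c H hH hc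
    filter_upwards [hloc n c] with c' hc'
    exact hn (hc' ▸ hf c' n)
  · refine fun c d => ⟨fun hR => ?_, ?_⟩
    · by_contra hdf
      obtain ⟨H, hH, hfH, hHd⟩ := compact_exists_isClopen_in_isOpen
        (isOpen_compl_singleton (x := d)) (fun hfd : f c = d => hdf hfd.symm)
      obtain ⟨n, hn⟩ := hfine2 c H hH hfH
      obtain ⟨p, hp, hc, hd⟩ := hR n
      obtain rfl := huniq n c p hp hc
      exact hHd (hn hd) rfl
    · rintro rfl n
      exact ⟨_, hcP n c, hcm n c, hf c n⟩
  · have hsum : Summable fun n : ℕ => (1 / 2 : ℝ) ^ n := summable_geometric_two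
    have hcont : ∀ n, Continuous fun c => gap N M (cell n c) := fun n =>
      IsLocallyConstant.continuous <| (IsLocallyConstant.iff_eventually_eq _).2 fun c =>
        (hloc n c).mono fun c' hc' => by rw [hc']
    refine ⟨fun c => gap N M (cell 0 c) +
      ∑' n, (gap N M (cell (n + 1) c) - gap N M (cell n c)), ?_, fun c hc => ?_⟩
    · exact (hcont 0).add (continuous_tsum (fun n => (hcont (n + 1)).sub (hcont n)) hsum
        fun n c => (hstep n c).2.2)
    · have hgap : Tendsto (fun n => gap N M (cell n c)) atTop (𝓝 (gap N M (cell 0 c) +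
          ∑' n, (gap N M (cell (n + 1) c) - gap N M (cell n c)))) := by
        have := (Summable.of_norm_bounded hsum fun n =>
          (hstep n c).2.2).hasSum.tendsto_sum_nat.const_add (gap N M (cell 0 c))
        refine this.congr fun n => ?_
        rw [Finset.sum_range_sub (fun n => gap N M (cell n c)), add_sub_cancel]
      have h1 := (ENNReal.tendsto_toReal hc).comp
        (hN.lsc.tendsto_infOn (hanti1 c) (hcm · c) (hfine1 c))
      have h2 := hM.lsc.tendsto_infOn (hanti2 c) (hf c) (hfine2 c)
      refine tendsto_nhds_unique h2
        ((ENNReal.continuous_ofReal.tendsto _).comp (h1.add hgap) |>.congr fun n => ?_)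
      have := hM.infOn_ne_top ((h.matching n).clopen_snd _ (hcP n c)).isOpen
        ((h.matching n).nonempty_snd _ (hcP n c))
      simp [gap, ENNReal.ofReal_toReal this]

end IsMatchingSeq

end MatchingSequence

theorem GraphDomain.continuous_ofReal_add {C : Type*} [TopologicalSpace C] {N : C → ℝ≥0∞}
    {β : C → ℝ} (hβ : Continuous β) :
    Continuous fun c : GraphDomain N => ENNReal.ofReal ((N c.1).toReal + β c.1) := by
  refine ENNReal.continuous_ofReal.comp (Continuous.add ?_ (hβ.comp continuous_val))
  exact continuous_iff_continuousAt.2 fun c =>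
    (ENNReal.tendsto_toReal c.2).comp continuous_apply.continuousAt

/-- Any two Lelek norms on compact metrizable zero-dimensional spaces have homeomorphic graphs. -/
theorem IsLelek.nonempty_homeomorph {C D : Type*} [TopologicalSpace C] [TopologicalSpace D]
    [CompactSpace C] [T2Space C] [TotallyDisconnectedSpace C] [SecondCountableTopology C]
    [CompactSpace D] [T2Space D] [TotallyDisconnectedSpace D] [SecondCountableTopology D]
    [Nonempty C] [Nonempty D] {N : C → ℝ≥0∞} {M : D → ℝ≥0∞} (hN : IsLelek N) (hM : IsLelek M) :
    Nonempty (GraphDomain N ≃ₜ GraphDomain M) := by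
  obtain ⟨P, hP⟩ := exists_isMatchingSeq hN hM
  obtain ⟨f, hf, hRf, β, hβ, hfβ⟩ := hP.exists_map hN hM
  obtain ⟨g, hg, hRg, γ, hγ, hgγ⟩ := hP.swap.exists_map hM hN
  have hRR : ∀ c d, IsMatchingSeq.Related P c d ↔
      IsMatchingSeq.Related (fun n => Prod.swap ⁻¹' (P n)) d c := fun c d =>
    forall_congr' fun n => ⟨fun ⟨p, hp, hc, hd⟩ => ⟨p.swap, by simpa using hp, hd, hc⟩,
      fun ⟨p, hp, hd, hc⟩ => ⟨p.swap, hp, hc, hd⟩⟩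
  have hgf : ∀ c, g (f c) = c := fun c => ((hRg _ _).1 ((hRR _ _).1 ((hRf _ _).2 rfl))).symm
  have hfg : ∀ d, f (g d) = d := fun d => ((hRf _ _).1 ((hRR _ _).2 ((hRg _ _).2 rfl))).symm
  refine ⟨⟨⟨fun c => ⟨f c.1, ?_⟩, fun d => ⟨g d.1, ?_⟩, fun c => Subtype.ext (hgf _),
    fun d => Subtype.ext (hfg _)⟩, ?_, ?_⟩⟩
  · rw [hfβ c.1 c.2]
    exact ENNReal.ofReal_ne_top
  · rw [hgγ d.1 d.2]
    exact ENNReal.ofReal_ne_top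
  · exact GraphDomain.continuous_iff.2 ⟨hf.comp GraphDomain.continuous_val,
      (GraphDomain.continuous_ofReal_add hβ).congr fun c => (hfβ c.1 c.2).symm⟩
  · exact GraphDomain.continuous_iff.2 ⟨hg.comp GraphDomain.continuous_val,
      (GraphDomain.continuous_ofReal_add hγ).congr fun d => (hgγ d.1 d.2).symm⟩

namespace HypFn

variable {n : ℕ} {X Y : Type*} [TopologicalSpace X] [TopologicalSpace Y]

theorem isOpen_setOf_subset {U : Set X} (hU : IsOpen U) : IsOpen {F : HypFn n X | F.1 ⊆ U} := by
  rcases U.eq_empty_or_nonempty with rfl | hne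
  · convert isOpen_empty
    exact eq_empty_iff_forall_notMem.2 fun F hF => (F.2.1.mono hF).ne_empty rfl
  · exact ⟨_, TopologicalSpace.GenerateOpen.basic _ (Or.inl ⟨U, hU, hne, rfl⟩), rfl⟩

theorem isOpen_setOf_inter_nonempty {U : Set X} (hU : IsOpen U) :
    IsOpen {F : HypFn n X | (F.1 ∩ U).Nonempty} := by
  rcases U.eq_empty_or_nonempty with rfl | hne
  · simp
  · exact ⟨_, TopologicalSpace.GenerateOpen.basic _ (Or.inr ⟨U, hU, hne, rfl⟩), rfl⟩

theorem tendsto_iff {α : Type*} {l : Filter α} {g : α → HypFn n X} {F : HypFn n X} :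
    Tendsto g l (𝓝 F) ↔
      (∀ U, IsOpen U → F.1 ⊆ U → ∀ᶠ y in l, (g y).1 ⊆ U) ∧
      (∀ U, IsOpen U → (F.1 ∩ U).Nonempty → ∀ᶠ y in l, ((g y).1 ∩ U).Nonempty) := by
  constructor
  · exact fun h => ⟨fun U hU hF => h.eventually ((isOpen_setOf_subset hU).mem_nhds hF),
      fun U hU hF => h.eventually ((isOpen_setOf_inter_nonempty hU).mem_nhds hF)⟩
  · rintro ⟨h1, h2⟩
    let _ : TopologicalSpace (Set X) := VietorisTop inferInstance
    rw [nhds_induced, tendsto_comap_iff]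
    refine TopologicalSpace.tendsto_nhds_generateFrom_iff.2 ?_
    rintro S (⟨U, hU, -, rfl⟩ | ⟨U, hU, -, rfl⟩) hF
    · exact h1 U hU hF
    · exact h2 U hU hF

/-- The map of symmetric products induced by a map. -/
def map (f : X → Y) (F : HypFn n X) : HypFn n Y :=
  ⟨f '' F.1, F.2.1.image f, F.2.2.1.image f, (ncard_image_le F.2.2.1).trans F.2.2.2⟩

theorem map_subset_iff {f : X → Y} {F : HypFn n X} {U : Set Y} :
    (map f F).1 ⊆ U ↔ F.1 ⊆ f ⁻¹' U := image_subset_iff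

theorem map_inter_nonempty_iff {f : X → Y} {F : HypFn n X} {U : Set Y} :
    ((map f F).1 ∩ U).Nonempty ↔ (F.1 ∩ f ⁻¹' U).Nonempty := image_inter_nonempty_iff

theorem continuous_map {f : X → Y} (hf : Continuous f) :
    Continuous (map f : HypFn n X → HypFn n Y) := by
  refine continuous_iff_continuousAt.2 fun F => tendsto_iff.2 ⟨fun U hU hF => ?_, fun U hU hF => ?_⟩
  · simp only [map_subset_iff] at hF ⊢
    exact (isOpen_setOf_subset (hU.preimage hf)).mem_nhds hF
  · simp only [map_inter_nonempty_iff] at hF ⊢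
    exact (isOpen_setOf_inter_nonempty (hU.preimage hf)).mem_nhds hF

theorem map_injective {f : X → Y} (hf : Function.Injective f) :
    Function.Injective (map f : HypFn n X → HypFn n Y) := fun _ _ h =>
  Subtype.ext (hf.image_injective (congrArg Subtype.val h))

theorem isInducing_map {f : X → Y} (hf : IsInducing f) :
    IsInducing (map f : HypFn n X → HypFn n Y) := by
  refine isInducing_iff_nhds.2 fun F =>
    le_antisymm (continuous_map hf.continuous).continuousAt.le_comap ?_
  obtain ⟨h1, h2⟩ := tendsto_iff.1 (tendsto_comap (f := map f) (x := 𝓝 (map f F)))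
  refine tendsto_id'.1 (tendsto_iff.2 ⟨fun U hU hF => ?_, fun U hU hF => ?_⟩)
  · obtain ⟨V, hV, rfl⟩ := hf.isOpen_iff.1 hU
    exact (h1 V hV (map_subset_iff.2 hF)).mono fun _ => map_subset_iff.1
  · obtain ⟨V, hV, rfl⟩ := hf.isOpen_iff.1 hU
    exact (h2 V hV (map_inter_nonempty_iff.2 hF)).mono fun _ => map_inter_nonempty_iff.1

theorem exists_map_eq {f : X → Y} (hf : Function.Injective f) {G : HypFn n Y}
    (hG : G.1 ⊆ range f) : ∃ F : HypFn n X, map f F = G := by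
  have h := image_preimage_eq_of_subset hG
  refine ⟨⟨f ⁻¹' G.1, ?_, G.2.2.1.preimage hf.injOn, ?_⟩, Subtype.ext h⟩
  · exact image_nonempty.1 (h ▸ G.2.1)
  · rw [← ncard_image_of_injective _ hf, h]
    exact G.2.2.2

theorem isClosedEmbedding_map {f : X → Y} (hf : IsClosedEmbedding f) :
    IsClosedEmbedding (map f : HypFn n X → HypFn n Y) := by
  refine ⟨⟨isInducing_map hf.isInducing, map_injective hf.injective⟩, ?_⟩
  have : range (map f : HypFn n X → HypFn n Y) = {G | (G.1 ∩ (range f)ᶜ).Nonempty}ᶜ := by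
    ext G
    rw [mem_compl_iff, mem_ofPred_eq, inter_compl_nonempty_iff, not_not]
    exact ⟨by rintro ⟨F, rfl⟩; exact image_subset_range _ _, exists_map_eq hf.injective⟩
  rw [this]
  exact (isOpen_setOf_inter_nonempty hf.isClosed_range.isOpen_compl).isClosed_compl

theorem isClopen_setOf_inter_nonempty {U : Set X} (hU : IsClopen U) :
    IsClopen {F : HypFn n X | (F.1 ∩ U).Nonempty} := by
  refine ⟨⟨?_⟩, isOpen_setOf_inter_nonempty hU.isOpen⟩
  convert isOpen_setOf_subset (n := n) hU.compl.isOpen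
  ext F
  simp [not_nonempty_iff_eq_empty, ← disjoint_iff_inter_eq_empty, subset_compl_iff_disjoint_right]

theorem compactSpace [CompactSpace X] (hn : 1 ≤ n) : CompactSpace (HypFn n X) := by
  have : Nonempty (Fin n) := ⟨⟨0, hn⟩⟩
  let r : (Fin n → X) → HypFn n X := fun v => ⟨range v, range_nonempty v, finite_range v, by
    rw [← image_univ]
    exact (ncard_image_le finite_univ).trans (by simp [ncard_univ])⟩
  have hr : Continuous r := by
    refine continuous_iff_continuousAt.2 fun v => tendsto_iff.2 ⟨fun U hU hF => ?_, ?_⟩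
    · have : ∀ᶠ w in 𝓝 v, ∀ i, w i ∈ U := eventually_all.2 fun i =>
        (continuous_apply i).continuousAt.eventually (hU.mem_nhds (hF ⟨i, rfl⟩))
      exact this.mono fun w hw => range_subset_iff.2 hw
    · rintro U hU ⟨_, ⟨i, rfl⟩, hi⟩
      filter_upwards [(continuous_apply i).continuousAt.eventually (hU.mem_nhds hi)] with w hw
      exact ⟨w i, ⟨i, rfl⟩, hw⟩
  have hs : Function.Surjective r := by
    intro F
    have := F.2.2.1.fintype
    have : Nonempty F.1 := F.2.1.to_subtype
    obtain ⟨e⟩ := Function.Embedding.nonempty_of_card_le (α := F.1) (β := Fin n)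
      (by
        rw [Fintype.card_fin, ← Nat.card_eq_fintype_card]
        exact F.2.2.2)
    refine ⟨Subtype.val ∘ Function.invFun e, Subtype.ext ?_⟩
    change range (Subtype.val ∘ Function.invFun e) = F.1
    rw [(Function.invFun_surjective e.injective).range_comp, Subtype.range_coe]
  exact hs.compactSpace hr

section Clopen

/-- The map recording which clopen sets a finite set meets. -/
def trace (F : HypFn n X) (U : TopologicalSpace.Clopens X) : Bool :=
  {F : HypFn n X | (F.1 ∩ U).Nonempty}.boolIndicator F

theorem continuous_trace : Continuous (trace : HypFn n X → TopologicalSpace.Clopens X → Bool) :=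
  continuous_pi fun U =>
    (continuous_boolIndicator_iff_isClopen _).2 (isClopen_setOf_inter_nonempty U.isClopen)

variable [CompactSpace X] [T2Space X] [TotallyDisconnectedSpace X]

theorem subset_of_trace_eq {F G : HypFn n X} (h : trace F = trace G) : F.1 ⊆ G.1 := by
  intro x hx
  by_contra hxG
  obtain ⟨U, hU, hxU, hUG⟩ := compact_exists_isClopen_in_isOpen
    G.2.2.1.isClosed.isOpen_compl hxG
  have h1 : trace F ⟨U, hU⟩ = true := (mem_iff_boolIndicator _ _).1 ⟨x, hx, hxU⟩
  rw [h] at h1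
  obtain ⟨y, hy, hyU⟩ := (mem_iff_boolIndicator _ _).2 h1
  exact hUG hyU hy

theorem trace_injective :
    Function.Injective (trace : HypFn n X → TopologicalSpace.Clopens X → Bool) := fun _ _ h =>
  Subtype.ext ((subset_of_trace_eq h).antisymm (subset_of_trace_eq h.symm))

theorem t2Space : T2Space (HypFn n X) := .of_injective_continuous trace_injective continuous_trace

theorem isEmbedding_trace (hn : 1 ≤ n) :
    IsEmbedding (trace : HypFn n X → TopologicalSpace.Clopens X → Bool) :=
  have := compactSpace (X := X) hn
  (continuous_trace.isClosedEmbedding trace_injective).isEmbedding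

theorem totallyDisconnectedSpace (hn : 1 ≤ n) : TotallyDisconnectedSpace (HypFn n X) :=
  ⟨(isEmbedding_trace hn).isTotallyDisconnected
    (isTotallyDisconnected_of_totallyDisconnectedSpace _)⟩

theorem secondCountableTopology [SecondCountableTopology X] (hn : 1 ≤ n) :
    SecondCountableTopology (HypFn n X) :=
  have : Countable (TopologicalSpace.Clopens X) :=
    TopologicalSpace.Clopens.countable_iff_secondCountable.2 inferInstance
  (isEmbedding_trace hn).secondCountableTopology

end Clopen

end HypFn

theorem ENNReal.eventually_lt_tsum {α ι : Type*} {l : Filter α} {f : α → ι → ℝ≥0∞}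
    {a : ι → ℝ≥0∞} (hf : ∀ i, Tendsto (fun y => f y i) l (𝓝 (a i))) :
    ∀ r < ∑' i, a i, ∀ᶠ y in l, r < ∑' i, f y i := by
  intro r hr
  rw [ENNReal.tsum_eq_iSup_sum, lt_iSup_iff] at hr
  obtain ⟨s, hs⟩ := hr
  filter_upwards [(tendsto_finsetSum s fun i _ => hf i).eventually_const_lt hs] with y hy
  exact hy.trans_le (ENNReal.sum_le_tsum s)

theorem ENNReal.tendsto_tsum_of_le {α ι : Type*} {l : Filter α} {f : α → ι → ℝ≥0∞}
    {a b : ι → ℝ≥0∞} (hf : ∀ i, Tendsto (fun y => f y i) l (𝓝 (a i)))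
    (hfb : ∀ᶠ y in l, ∀ i, f y i ≤ b i) (hb : ∑' i, b i ≠ ∞) :
    Tendsto (fun y => ∑' i, f y i) l (𝓝 (∑' i, a i)) := by
  rcases l.eq_or_neBot with rfl | hl
  · exact tendsto_bot
  have hab : ∀ i, a i ≤ b i := fun i => le_of_tendsto (hf i) (hfb.mono fun y hy => hy i)
  have hbi : ∀ i, b i ≠ ∞ := ENNReal.ne_top_of_tsum_ne_top hb
  have hsum : ∑' i, a i + ∑' i, (b i - a i) = ∑' i, b i := by
    rw [← ENNReal.tsum_add]
    exact tsum_congr fun i => add_tsub_cancel_of_le (hab i)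
  refine ENNReal.tendsto_of_tendsto_add (g := fun y => ∑' i, (b i - f y i))
    (b := ∑' i, (b i - a i)) (ENNReal.eventually_lt_tsum hf)
    (ENNReal.eventually_lt_tsum fun i => ?_) ?_ (hsum ▸ hb)
  · exact ENNReal.Tendsto.sub tendsto_const_nhds (hf i) (Or.inl (hbi i))
  · rw [hsum]
    refine tendsto_const_nhds.congr' (hfb.mono fun y hy => ?_)
    beta_reduce
    rw [← ENNReal.tsum_add]
    exact tsum_congr fun i => (add_tsub_cancel_of_le (hy i)).symm

theorem GraphDomain.exists_isClopen_of_mem_nhds {C : Type*} [TopologicalSpace C] [CompactSpace C]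
    [T2Space C] [TotallyDisconnectedSpace C] {N : C → ℝ≥0∞} (hN : LowerSemicontinuous N)
    {x : GraphDomain N} {U : Set (GraphDomain N)} (hU : U ∈ 𝓝 x) {A : Set C} (hA : A ∈ 𝓝 x.1) :
    ∃ V ⊆ A, IsClopen V ∧ x.1 ∈ V ∧ ∃ s, N x.1 < s ∧
      ∀ y : GraphDomain N, y.1 ∈ V → N y.1 < s → y ∈ U := by
  rw [nhds_induced, mem_comap] at hU
  obtain ⟨S, hS, hSU⟩ := hU
  obtain ⟨E, hE, B, hB, hEB⟩ := mem_nhds_prod_iff.1 hS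
  obtain ⟨s, hs, hsB⟩ := exists_Ico_subset_of_mem_nhds hB ⟨∞, x.2.lt_top⟩
  have hlow : ∀ᶠ c in 𝓝 x.1, N c < N x.1 → N c ∈ B := by
    rcases eq_zero_or_pos (N x.1) with h0 | h0
    · simp [h0]
    · obtain ⟨r, hr, hrB⟩ := exists_Ioc_subset_of_mem_nhds hB ⟨0, h0⟩
      filter_upwards [hN x.1 r hr] with c hc hcx
      exact hrB ⟨hc, hcx.le⟩
  obtain ⟨G, hG, hGo, hxG⟩ := mem_nhds_iff.1 (inter_mem (inter_mem hE hA) hlow)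
  obtain ⟨V, hV, hxV, hVG⟩ := compact_exists_isClopen_in_isOpen hGo hxG
  refine ⟨V, fun c hc => (hG (hVG hc)).1.2, hV, hxV, s, hs, fun y hy hys => hSU (hEB ⟨?_, ?_⟩)⟩
  · exact (hG (hVG hy)).1.1
  · rcases lt_or_ge (N y.1) (N x.1) with h | h
    · exact (hG (hVG hy)).2 h
    · exact hsB ⟨h, hys⟩

/-- The supremum of `N` over a set. -/
def supOn {C : Type*} (N : C → ℝ≥0∞) (U : Set C) : ℝ≥0∞ := ⨆ c ∈ U, N c

theorem le_supOn {C : Type*} {N : C → ℝ≥0∞} {U : Set C} {c : C} (hc : c ∈ U) : N c ≤ supOn N U :=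
  le_iSup₂ (f := fun c (_ : c ∈ U) => N c) c hc

theorem supOn_le {C : Type*} {N : C → ℝ≥0∞} {U : Set C} {r : ℝ≥0∞} (h : ∀ c ∈ U, N c ≤ r) :
    supOn N U ≤ r := iSup₂_le h

theorem lt_supOn_iff {C : Type*} {N : C → ℝ≥0∞} {U : Set C} {r : ℝ≥0∞} :
    r < supOn N U ↔ ∃ c ∈ U, r < N c := by
  simp [supOn, lt_iSup_iff]

theorem supOn_ne_top {C : Type*} {N : C → ℝ≥0∞} {F : Set C} (hF : F.Finite)
    (h : ∀ x ∈ F, N x ≠ ∞) : supOn N F ≠ ∞ := by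
  rcases F.eq_empty_or_nonempty with rfl | hne
  · simp [supOn]
  · obtain ⟨x, hx, hmax⟩ := exists_max_image F N hF hne
    exact ne_top_of_le_ne_top (h x hx) (supOn_le hmax)

section Hyperspace

variable {C : Type*} [TopologicalSpace C] {N : C → ℝ≥0∞} {n : ℕ}
  {w : TopologicalSpace.Clopens C → ℝ≥0∞}

/-- The extension of `N` to finite sets: a weighted sum of the suprema over all clopen sets. -/
def hypNorm (N : C → ℝ≥0∞) (n : ℕ) (w : TopologicalSpace.Clopens C → ℝ≥0∞) (F : HypFn n C) :
    ℝ≥0∞ := ∑' U : TopologicalSpace.Clopens C, w U * supOn N (F.1 ∩ U)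

theorem lowerSemicontinuous_supOn (hN : LowerSemicontinuous N) {U : Set C} (hU : IsOpen U) :
    LowerSemicontinuous fun F : HypFn n C => supOn N (F.1 ∩ U) := by
  refine lowerSemicontinuous_iff_isOpen_preimage.2 fun r => ?_
  convert HypFn.isOpen_setOf_inter_nonempty (n := n) (hU.inter (hN.isOpen_preimage r))
  ext F
  simp only [mem_preimage, mem_Ioi, lt_supOn_iff]
  exact ⟨fun ⟨c, hc, h⟩ => ⟨c, hc.1, hc.2, h⟩, fun ⟨c, hc, hc', h⟩ => ⟨c, ⟨hc, hc'⟩, h⟩⟩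

theorem lowerSemicontinuous_mul_supOn (hN : LowerSemicontinuous N)
    (hw : ∀ U, w U ≠ ∞) (U : TopologicalSpace.Clopens C) :
    LowerSemicontinuous fun F : HypFn n C => w U * supOn N (F.1 ∩ U) :=
  (ENNReal.continuous_const_mul (hw U)).comp_lowerSemicontinuous
    (lowerSemicontinuous_supOn hN U.isClopen.isOpen) fun _ _ h => mul_le_mul_right h _

theorem lowerSemicontinuous_hypNorm (hN : LowerSemicontinuous N) (hw : ∀ U, w U ≠ ∞) :
    LowerSemicontinuous (hypNorm N n w) :=
  lowerSemicontinuous_tsum (lowerSemicontinuous_mul_supOn hN hw)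

theorem hypNorm_ne_top_iff (hw0 : ∀ U, w U ≠ 0) (hw : ∑' U, w U ≠ ∞) {F : HypFn n C} :
    hypNorm N n w F ≠ ∞ ↔ ∀ x ∈ F.1, N x ≠ ∞ := by
  constructor
  · intro h x hx hNx
    refine ENNReal.ne_top_of_tsum_ne_top h ⊤ ?_
    have : supOn N (F.1 ∩ ((⊤ : TopologicalSpace.Clopens C) : Set C)) = ∞ :=
      top_le_iff.1 (hNx ▸ le_supOn ⟨hx, by simp⟩)
    rw [this, ENNReal.mul_top (hw0 _)]
  · intro h
    refine ne_top_of_le_ne_top (ENNReal.mul_ne_top hw (supOn_ne_top F.2.2.1 h)) ?_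
    rw [← ENNReal.tsum_mul_right]
    refine ENNReal.tsum_le_tsum fun U => ?_
    gcongr
    exact supOn_le fun c hc => le_supOn hc.1

theorem tendsto_supOn_of_tendsto_hypNorm (hN : LowerSemicontinuous N) (hw0 : ∀ U, w U ≠ 0)
    (hw : ∀ U, w U ≠ ∞) {α : Type*} {l : Filter α} {g : α → HypFn n C} {F : HypFn n C}
    (hg : Tendsto g l (𝓝 F))
    (hgN : Tendsto (fun y => hypNorm N n w (g y)) l (𝓝 (hypNorm N n w F)))
    (hF : hypNorm N n w F ≠ ∞) (U : TopologicalSpace.Clopens C) :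
    Tendsto (fun y => supOn N ((g y).1 ∩ U)) l (𝓝 (supOn N (F.1 ∩ U))) := by
  classical
  have hsplit : ∀ G : HypFn n C, hypNorm N n w G = w U * supOn N (G.1 ∩ U) +
      ∑' V, if V = U then 0 else w V * supOn N (G.1 ∩ V) := fun G =>
    ENNReal.tsum_eq_add_tsum_ite U
  have hrest : LowerSemicontinuous fun G : HypFn n C =>
      ∑' V, if V = U then 0 else w V * supOn N (G.1 ∩ V) := by
    refine lowerSemicontinuous_tsum fun V => ?_
    by_cases hV : V = U
    · simp only [hV, if_true]
      exact lowerSemicontinuous_const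
    · simp only [hV, if_false]
      exact lowerSemicontinuous_mul_supOn hN hw V
  simp only [hsplit] at hgN hF
  have h := ENNReal.tendsto_of_tendsto_add
    ((lowerSemicontinuous_mul_supOn hN hw U).eventually_lt hg) (hrest.eventually_lt hg) hgN hF
  have := ENNReal.Tendsto.const_mul (a := (w U)⁻¹) h (Or.inr (ENNReal.inv_ne_top.2 (hw0 U)))
  simpa only [ENNReal.inv_mul_cancel_left (hw0 U) (hw U)] using this

/-- The underlying finite subset of `C`. -/
abbrev HypFn.carrier (F : HypFn n (GraphDomain N)) : HypFn n C :=
  HypFn.map (fun x : GraphDomain N => x.1) F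

theorem HypFn.le_supOn_carrier {F : HypFn n (GraphDomain N)} {x : GraphDomain N} (hx : x ∈ F.1)
    {U : Set C} (hxU : x.1 ∈ U) : N x.1 ≤ supOn N (F.carrier.1 ∩ U) :=
  le_supOn ⟨mem_image_of_mem _ hx, hxU⟩

theorem tendsto_supOn_carrier (hN : LowerSemicontinuous N) (F : HypFn n (GraphDomain N))
    {U : Set C} (hU : IsClopen U) :
    Tendsto (fun G : HypFn n (GraphDomain N) => supOn N (G.carrier.1 ∩ U)) (𝓝 F)
      (𝓝 (supOn N (F.carrier.1 ∩ U))) := by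
  refine tendsto_order.2 ⟨(lowerSemicontinuous_supOn hN hU.isOpen).eventually_lt
    (HypFn.continuous_map GraphDomain.continuous_val).continuousAt, fun r hr => ?_⟩
  obtain ⟨s, hs, hsr⟩ := exists_between hr
  have hopen : IsOpen {x : GraphDomain N | x.1 ∉ U ∨ N x.1 < s} :=
    (hU.compl.isOpen.preimage GraphDomain.continuous_val).union
      (isOpen_Iio.preimage GraphDomain.continuous_apply)
  have hF : F.1 ⊆ {x : GraphDomain N | x.1 ∉ U ∨ N x.1 < s} := fun x hx =>
    or_iff_not_imp_left.2 fun hxU =>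
      (HypFn.le_supOn_carrier hx (not_not.1 hxU)).trans_lt hs
  filter_upwards [(HypFn.isOpen_setOf_subset hopen).mem_nhds hF] with G hG
  refine (supOn_le ?_).trans_lt hsr
  rintro _ ⟨⟨x, hx, rfl⟩, hxU⟩
  exact ((hG hx).resolve_left (not_not.2 hxU)).le

variable [CompactSpace C] [T2Space C] [TotallyDisconnectedSpace C]

theorem HypFn.tendsto_graphDomain (hN : LowerSemicontinuous N) {α : Type*} {l : Filter α}
    {g : α → HypFn n (GraphDomain N)} {F : HypFn n (GraphDomain N)}
    (hg : Tendsto (fun y => (g y).carrier) l (𝓝 F.carrier))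
    (hsup : ∀ U : TopologicalSpace.Clopens C,
      Tendsto (fun y => supOn N ((g y).carrier.1 ∩ U)) l
        (𝓝 (supOn N (F.carrier.1 ∩ U)))) :
    Tendsto g l (𝓝 F) := by
  have key : ∀ U : Set (GraphDomain N), IsOpen U → ∀ x ∈ F.1, x ∈ U → ∃ V : Set C, IsClopen V ∧
      x.1 ∈ V ∧ ∀ᶠ y in l, ∀ z ∈ (g y).1, z.1 ∈ V → z ∈ U := by
    intro U hU x hx hxU
    have hA : (Subtype.val '' (F.1 \ {x}))ᶜ ∈ 𝓝 x.1 := by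
      refine (F.2.2.1.sdiff.image _).isClosed.isOpen_compl.mem_nhds ?_
      rintro ⟨z, ⟨-, hz⟩, hzx⟩
      exact hz (Subtype.ext hzx)
    obtain ⟨V, hVA, hV, hxV, s, hs, hVU⟩ :=
      GraphDomain.exists_isClopen_of_mem_nhds hN (hU.mem_nhds hxU) hA
    refine ⟨V, hV, hxV, ?_⟩
    have hle : supOn N (F.carrier.1 ∩ V) ≤ N x.1 := by
      refine supOn_le ?_
      rintro _ ⟨⟨z, hz, rfl⟩, hzV⟩
      rcases eq_or_ne z x with rfl | hzx
      · exact le_rfl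
      · exact absurd ⟨z, ⟨hz, hzx⟩, rfl⟩ (hVA hzV)
    filter_upwards [(hsup ⟨V, hV⟩).eventually_lt_const (hle.trans_lt hs)] with y hy z hz hzV
    exact hVU z hzV ((HypFn.le_supOn_carrier hz hzV).trans_lt hy)
  obtain ⟨hg1, hg2⟩ := HypFn.tendsto_iff.1 hg
  refine HypFn.tendsto_iff.2 ⟨fun U hU hF => ?_, ?_⟩
  · choose! V hV hxV hVU using fun x hx => key U hU x hx (hF hx)
    filter_upwards [hg1 (⋃ x ∈ F.1, V x) (isOpen_biUnion fun x hx => (hV x hx).isOpen)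
      (by
        rintro _ ⟨x, hx, rfl⟩
        exact mem_biUnion hx (hxV x hx)),
      (eventually_all_finite F.2.2.1).2 hVU] with y hy1 hy2 z hz
    obtain ⟨x, hx, hzx⟩ := mem_iUnion₂.1 (hy1 (mem_image_of_mem _ hz))
    exact hy2 x hx z hz hzx
  · rintro U hU ⟨x, hx, hxU⟩
    obtain ⟨V, hV, hxV, hVU⟩ := key U hU x hx hxU
    filter_upwards [hVU, hg2 V hV.isOpen ⟨x.1, mem_image_of_mem _ hx, hxV⟩] with y hy1 hy2
    obtain ⟨_, ⟨z, hz, rfl⟩, hzV⟩ := hy2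
    exact ⟨z, hz, hy1 z hz hzV⟩

/-- The symmetric product of a graph domain is a graph domain over the symmetric product. -/
theorem HypFn.nonempty_homeomorph_graphDomain (hN : LowerSemicontinuous N) (hw0 : ∀ U, w U ≠ 0)
    (hw : ∑' U, w U ≠ ∞) :
    Nonempty (HypFn n (GraphDomain N) ≃ₜ GraphDomain (hypNorm N n w)) := by
  have hwt : ∀ U, w U ≠ ∞ := ENNReal.ne_top_of_tsum_ne_top hw
  let j : HypFn n (GraphDomain N) → GraphDomain (hypNorm N n w) := fun F =>
    ⟨F.carrier, (hypNorm_ne_top_iff hw0 hw).2 (by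
      rintro _ ⟨x, -, rfl⟩
      exact x.2)⟩
  have hval : Continuous fun F => (j F).1 := HypFn.continuous_map GraphDomain.continuous_val
  have hj : Continuous j := by
    refine GraphDomain.continuous_iff.2 ⟨hval, continuous_iff_continuousAt.2 fun F => ?_⟩
    obtain ⟨B, hB, hB'⟩ := exists_between (supOn_ne_top (N := N) (j F).1.2.2.1
      ((hypNorm_ne_top_iff hw0 hw).1 (j F).2)).lt_top
    refine ENNReal.tendsto_tsum_of_le (b := fun U => w U * B) (fun U => ?_) ?_ ?_
    · exact ENNReal.Tendsto.const_mul (tendsto_supOn_carrier hN F U.isClopen) (Or.inr (hwt U))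
    · have h := tendsto_supOn_carrier hN F isClopen_univ
      simp only [inter_univ] at h
      filter_upwards [h.eventually_lt_const hB] with G hG U
      gcongr
      exact (supOn_le fun c hc => le_supOn hc.1).trans hG.le
    · rw [ENNReal.tsum_mul_right]
      exact ENNReal.mul_ne_top hw hB'.ne
  have hinj : Function.Injective j := fun F G h =>
    HypFn.map_injective (f := fun x : GraphDomain N => x.1) Subtype.val_injective
      (congrArg Subtype.val h)
  have hsurj : Function.Surjective j := by
    intro F
    obtain ⟨G, hG⟩ := HypFn.exists_map_eq (f := fun x : GraphDomain N => x.1)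
      Subtype.val_injective (G := F.1)
      fun x hx => ⟨⟨x, (hypNorm_ne_top_iff hw0 hw).1 F.2 x hx⟩, rfl⟩
    exact ⟨G, Subtype.ext hG⟩
  have hind : IsInducing j := by
    refine isInducing_iff_nhds.2 fun F => le_antisymm hj.continuousAt.le_comap ?_
    obtain ⟨h1, h2⟩ := GraphDomain.tendsto_iff.1 (tendsto_comap (f := j) (x := 𝓝 (j F)))
    exact tendsto_id'.1 (HypFn.tendsto_graphDomain hN h1
      (tendsto_supOn_of_tendsto_hypNorm hN hw0 hwt h1 h2 (j F).2))
  exact ⟨(Equiv.ofBijective j ⟨hinj, hsurj⟩).toHomeomorphOfIsInducing hind⟩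

end Hyperspace

/-- The list of the first `n` terms of a sequence. -/
def initSeg (x : ℕ → ℕ) (n : ℕ) : List ℕ := (List.range n).map x

section InitialSegments

variable {x y : ℕ → ℕ} {n m : ℕ}

@[simp]
theorem length_initSeg (x : ℕ → ℕ) (n : ℕ) : (initSeg x n).length = n := by simp [initSeg]

@[simp]
theorem initSeg_zero (x : ℕ → ℕ) : initSeg x 0 = [] := rfl

theorem initSeg_succ (x : ℕ → ℕ) (n : ℕ) : initSeg x (n + 1) = initSeg x n ++ [x n] := by
  simp [initSeg, List.range_succ]

theorem initSeg_eq_iff : initSeg x n = initSeg y n ↔ ∀ i < n, x i = y i := by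
  simp [initSeg, List.map_inj_left]

theorem initSeg_eq_of_le (h : initSeg x n = initSeg y n) (hmn : m ≤ n) :
    initSeg x m = initSeg y m :=
  initSeg_eq_iff.2 fun i hi => initSeg_eq_iff.1 h i (hi.trans_le hmn)

theorem initSeg_succ_eq_append_iff {σ : List ℕ} {j : ℕ} :
    initSeg x (σ.length + 1) = σ ++ [j] ↔ initSeg x σ.length = σ ∧ x σ.length = j := by
  rw [initSeg_succ]
  refine ⟨fun h => ?_, fun ⟨h1, h2⟩ => by rw [h1, h2]⟩
  simpa using List.append_inj' h (by simp)

theorem exists_seq_eq_of_initSeg (c : List ℕ → ℕ) : ∃ x : ℕ → ℕ, ∀ n, x n = c (initSeg x n) := by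
  let s : ℕ → List ℕ := fun n => Nat.rec [] (fun _ σ => σ ++ [c σ]) n
  have hs : ∀ n, initSeg (fun k => c (s k)) n = s n := by
    intro n
    induction n with
    | zero => rfl
    | succ n ih => rw [initSeg_succ, ih]
  exact ⟨fun k => c (s k), fun n => by rw [hs]⟩

theorem tendsto_nhds_iff_initSeg {α : Type*} {l : Filter α} {g : α → ℕ → ℕ} :
    Tendsto g l (𝓝 x) ↔ ∀ n, ∀ᶠ y in l, initSeg (g y) n = initSeg x n := by
  simp only [tendsto_pi_nhds, nhds_discrete, tendsto_pure, initSeg_eq_iff]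
  refine ⟨fun h n => (eventually_all_finite (finite_Iio n)).2 fun i _ => h i, fun h n => ?_⟩
  exact (h (n + 1)).mono fun y hy => hy n n.lt_succ_self

end InitialSegments

/-- The branches of the tree of initial segments of elements of `S`, topologized so that `z σ` is
the limit of the other immediate successors of each node `σ`. -/
def Branch (S : Set (ℕ → ℕ)) (_z : List ℕ → ℕ) : Type :=
  {x : ℕ → ℕ // ∀ n, ∃ y ∈ S, initSeg y n = initSeg x n}

namespace Branch

variable {S : Set (ℕ → ℕ)} {z : List ℕ → ℕ}

/-- The nodes of the form `σ ++ [j]`, with `j ≠ z σ`, lying on a branch. -/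
def code (x : Branch S z) (p : List ℕ × ℕ) : Bool :=
  decide (p.2 ≠ z p.1 ∧ initSeg x.1 (p.1.length + 1) = p.1 ++ [p.2])

instance : TopologicalSpace (Branch S z) := .induced code inferInstance

theorem isInducing_code : IsInducing (code : Branch S z → _) := ⟨rfl⟩

theorem tendsto_iff {α : Type*} {l : Filter α} {g : α → Branch S z} {x : Branch S z} :
    Tendsto g l (𝓝 x) ↔ ∀ σ j, j ≠ z σ → ∀ᶠ y in l,
      (initSeg (g y).1 (σ.length + 1) = σ ++ [j] ↔ initSeg x.1 (σ.length + 1) = σ ++ [j]) := by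
  rw [isInducing_code.tendsto_nhds_iff, tendsto_pi_nhds]
  simp only [nhds_discrete, tendsto_pure, Prod.forall, Function.comp_apply, code,
    decide_eq_decide]
  refine forall₂_congr fun σ j => ?_
  by_cases hj : j = z σ <;> simp [hj]

theorem tendsto_of_initSeg {α : Type*} {l : Filter α} {g : α → Branch S z} {x : Branch S z}
    (h : ∀ n, ∀ᶠ y in l, initSeg (g y).1 n = initSeg x.1 n) : Tendsto g l (𝓝 x) :=
  tendsto_iff.2 fun σ j _ => (h (σ.length + 1)).mono fun y hy => by rw [hy]

theorem code_injective : Function.Injective (code : Branch S z → _) := by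
  intro x y h
  have key : ∀ (x y : Branch S z), code x = code y → ∀ n, initSeg x.1 n = initSeg y.1 n →
      x.1 n ≠ z (initSeg x.1 n) → x.1 n = y.1 n := by
    intro x y h n hn hx
    have := congrFun h (initSeg x.1 n, x.1 n)
    simp only [code, decide_eq_decide, length_initSeg] at this
    have h2 := (this.1 ⟨hx, initSeg_succ _ _⟩).2
    rw [hn, initSeg_succ] at h2
    simpa using h2.symm
  have hpre : ∀ n, initSeg x.1 n = initSeg y.1 n := by
    intro n
    induction n with
    | zero => rfl
    | succ n ih =>
      have : x.1 n = y.1 n := by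
        by_cases hx : x.1 n = z (initSeg x.1 n)
        · by_cases hy : y.1 n = z (initSeg y.1 n)
          · rw [hx, hy, ih]
          · exact (key y x h.symm n ih.symm hy).symm
        · exact key x y h n ih hx
      rw [initSeg_succ, initSeg_succ, ih, this]
  exact Subtype.ext (funext fun n => initSeg_eq_iff.1 (hpre (n + 1)) n n.lt_succ_self)

theorem isEmbedding_code : IsEmbedding (code : Branch S z → _) := ⟨isInducing_code, code_injective⟩

instance : T2Space (Branch S z) := isEmbedding_code.t2Space

instance : SecondCountableTopology (Branch S z) := isEmbedding_code.secondCountableTopology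

instance : TotallyDisconnectedSpace (Branch S z) :=
  ⟨isEmbedding_code.isTotallyDisconnected (isTotallyDisconnected_of_totallyDisconnectedSpace _)⟩

theorem compactSpace (hz : ∀ y ∈ S, ∀ n, ∃ y' ∈ S,
    initSeg y' (n + 1) = initSeg y n ++ [z (initSeg y n)]) (hS : S.Nonempty) :
    CompactSpace (Branch S z) := by
  classical
  refine ⟨isCompact_iff_ultrafilter_le_nhds.2 fun l _ => ?_⟩
  let cyl : List ℕ → Set (Branch S z) := fun σ => {y | initSeg y.1 σ.length = σ}
  let c : List ℕ → ℕ := fun σ =>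
    if h : ∃ j, j ≠ z σ ∧ cyl (σ ++ [j]) ∈ l then h.choose else z σ
  have hc : ∀ σ j, j ≠ z σ → cyl (σ ++ [j]) ∈ l → c σ = j := by
    intro σ j hj hjl
    have h : ∃ j, j ≠ z σ ∧ cyl (σ ++ [j]) ∈ l := ⟨j, hj, hjl⟩
    have hcσ : c σ = h.choose := dif_pos h
    obtain ⟨y, hy1, hy2⟩ := l.nonempty_of_mem (inter_mem hjl h.choose_spec.2)
    have h1 : initSeg y.1 (σ ++ [j]).length = σ ++ [j] := hy1
    have h2 : initSeg y.1 (σ ++ [h.choose]).length = σ ++ [h.choose] := hy2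
    simp only [List.length_append, List.length_singleton] at h1 h2
    rw [hcσ]
    simpa using h2.symm.trans h1
  have hc' : ∀ σ, c σ ≠ z σ → cyl (σ ++ [c σ]) ∈ l := by
    intro σ hσ
    by_cases h : ∃ j, j ≠ z σ ∧ cyl (σ ++ [j]) ∈ l
    · have hcσ : c σ = h.choose := dif_pos h
      rw [hcσ]
      exact h.choose_spec.2
    · exact absurd (dif_neg h) hσ
  obtain ⟨x, hx⟩ := exists_seq_eq_of_initSeg c
  have hxS : ∀ n, ∃ y ∈ S, initSeg y n = initSeg x n := by
    intro n
    induction n with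
    | zero =>
      obtain ⟨y, hy⟩ := hS
      exact ⟨y, hy, rfl⟩
    | succ n ih =>
      obtain ⟨y, hy, hyn⟩ := ih
      rw [initSeg_succ x, hx n]
      by_cases h : c (initSeg x n) = z (initSeg x n)
      · rw [h, ← hyn]
        exact hz y hy n
      · obtain ⟨u, hu⟩ := l.nonempty_of_mem (hc' _ h)
        have hu' : initSeg u.1 (initSeg x n ++ [c (initSeg x n)]).length = _ := hu
        simp only [List.length_append, List.length_singleton, length_initSeg] at hu'
        rw [← hu']
        exact u.2 (n + 1)
  have hcyl : ∀ σ, cyl σ ∈ l → initSeg x σ.length = σ := by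
    intro σ
    induction σ using List.reverseRecOn with
    | nil => exact fun _ => rfl
    | append_singleton σ i ih =>
      intro hi
      have hsub : cyl (σ ++ [i]) ⊆ cyl σ := by
        intro y hy
        have hy' : initSeg y.1 (σ ++ [i]).length = σ ++ [i] := hy
        rw [List.length_append, List.length_singleton, initSeg_succ_eq_append_iff] at hy'
        exact hy'.1
      have hσ := ih (mem_of_superset hi hsub)
      rw [List.length_append, List.length_singleton, initSeg_succ_eq_append_iff]
      refine ⟨hσ, ?_⟩
      rw [hx, hσ]
      by_cases hiz : i = z σ
      · by_contra hne
        have hcl := hc' σ (hiz ▸ hne)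
        obtain ⟨y, hy1, hy2⟩ := l.nonempty_of_mem (inter_mem hi hcl)
        have h1 : initSeg y.1 (σ ++ [i]).length = σ ++ [i] := hy1
        have h2 : initSeg y.1 (σ ++ [c σ]).length = σ ++ [c σ] := hy2
        simp only [List.length_append, List.length_singleton] at h1 h2
        exact hne (by simpa using h2.symm.trans h1)
      · exact hc σ i hiz hi
  refine ⟨⟨x, hxS⟩, mem_univ _, tendsto_id'.1 (tendsto_iff.2 fun σ j hj => ?_)⟩
  by_cases h : cyl (σ ++ [j]) ∈ l
  · have hxj := hcyl _ h
    rw [List.length_append, List.length_singleton] at hxj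
    filter_upwards [h] with y hy
    have hy' : initSeg y.1 (σ ++ [j]).length = σ ++ [j] := hy
    rw [List.length_append, List.length_singleton] at hy'
    exact iff_of_true hy' hxj
  · have hxj : ¬ initSeg x (σ.length + 1) = σ ++ [j] := by
      intro hxj
      obtain ⟨h1, h2⟩ := initSeg_succ_eq_append_iff.1 hxj
      rw [hx, h1] at h2
      exact h (h2 ▸ hc' σ (h2 ▸ hj))
    filter_upwards [Ultrafilter.compl_mem_iff_notMem.2 h] with y hy
    refine iff_of_false (fun hy' => hy ?_) hxj
    change initSeg y.1 (σ ++ [j]).length = σ ++ [j]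
    rwa [List.length_append, List.length_singleton]

/-- An ultrafilter converging to a branch either converges pointwise, or it eventually leaves the
branch at a node after which the branch consists of limit successors. -/
theorem initSeg_or_exists_leave {x : Branch S z} {l : Ultrafilter (Branch S z)}
    (hl : (l : Filter _) ≤ 𝓝 x) :
    (∀ n, ∀ᶠ y in (l : Filter (Branch S z)), initSeg y.1 n = initSeg x.1 n) ∨
    ∃ n, (∀ m, n ≤ m → x.1 m = z (initSeg x.1 m)) ∧ ∀ᶠ y in (l : Filter (Branch S z)),
      initSeg y.1 n = initSeg x.1 n ∧ y.1 n ≠ z (initSeg y.1 n) := by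
  classical
  rw [or_iff_not_imp_left]
  intro h
  push Not at h
  obtain ⟨n, hn, hmin⟩ : ∃ n, (¬ ∀ᶠ y in (l : Filter (Branch S z)),
      initSeg y.1 (n + 1) = initSeg x.1 (n + 1)) ∧ ∀ᶠ y in (l : Filter (Branch S z)),
      initSeg y.1 n = initSeg x.1 n := by
    have h' : ∃ n, ¬ ∀ᶠ y in (l : Filter (Branch S z)), initSeg y.1 n = initSeg x.1 n := by
      simpa using h
    obtain ⟨k, hk⟩ : ∃ k, Nat.find h' = k + 1 :=
      Nat.exists_eq_succ_of_ne_zero fun h0 => (h0 ▸ Nat.find_spec h') (by simp)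
    exact ⟨k, hk ▸ Nat.find_spec h', not_not.1 (Nat.find_min h' (by lia))⟩
  have htail : ∀ m, n ≤ m → x.1 m = z (initSeg x.1 m) := by
    intro m hnm
    by_contra hm
    refine hn ?_
    filter_upwards [tendsto_iff.1 (tendsto_id'.2 hl) (initSeg x.1 m) (x.1 m) hm] with y hy
    rw [length_initSeg, ← initSeg_succ] at hy
    exact initSeg_eq_of_le (hy.2 rfl) (by lia)
  refine ⟨n, htail, ?_⟩
  filter_upwards [hmin, Ultrafilter.eventually_not.2 hn] with y hy1 hy2
  refine ⟨hy1, fun hyz => hy2 ?_⟩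
  rw [initSeg_succ, initSeg_succ, hyz, htail n le_rfl, hy1]

theorem exists_mem_of_isOpen {U : Set (Branch S z)} (hU : IsOpen U) (hne : U.Nonempty) :
    ∃ x ∈ U, x.1 ∈ S := by
  obtain ⟨x, hx⟩ := hne
  choose y hyS hy using x.2
  let g : ℕ → Branch S z := fun n => ⟨y n, fun _ => ⟨y n, hyS n, rfl⟩⟩
  have hlim : Tendsto g atTop (𝓝 x) :=
    tendsto_of_initSeg fun n => (eventually_ge_atTop n).mono fun m hm =>
      initSeg_eq_of_le (hy m) hm
  obtain ⟨n, hn⟩ := (hlim.eventually (hU.mem_nhds hx)).exists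
  exact ⟨_, hn, hyS n⟩

end Branch

/-- A coding of a space by sequences of natural numbers which determines the topology together
with a finite-valued function, and is complete on sets where that function is bounded. -/
structure IsCoding {A : Type*} [TopologicalSpace A] (ν : A → ℝ≥0∞) (idx : A → ℕ → ℕ) : Prop where
  ne_top : ∀ a, ν a ≠ ∞
  continuous_norm : Continuous ν
  continuous_idx : Continuous idx
  injective : Function.Injective idx
  le_nhds : ∀ a (l : Filter A), Tendsto idx l (𝓝 (idx a)) → Tendsto ν l (𝓝 (ν a)) → l ≤ 𝓝 a
  exists_eq : ∀ (x : ℕ → ℕ) (s : ℝ≥0∞), s ≠ ∞ →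
    (∀ n, ∃ a, initSeg (idx a) n = initSeg x n ∧ ν a < s + 2⁻¹ ^ n) → ∃ a, idx a = x ∧ ν a ≤ s

/-- The infimum of `ν` over the points whose code extends `σ`. -/
def cellInf {A : Type*} (ν : A → ℝ≥0∞) (idx : A → ℕ → ℕ) (σ : List ℕ) : ℝ≥0∞ :=
  infOn ν {a | initSeg (idx a) σ.length = σ}

/-- The summand added to the norm of a branch which leaves the limit successor at stage `i`. -/
def penalty (z : List ℕ → ℕ) (x : ℕ → ℕ) (i : ℕ) : ℝ≥0∞ :=
  if x i = z (initSeg x i) then 0 else 3 * 2⁻¹ ^ i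

/-- The norm of a branch computed from its first `n` steps. -/
def partialNorm {A : Type*} (ν : A → ℝ≥0∞) (idx : A → ℕ → ℕ) (z : List ℕ → ℕ) (x : ℕ → ℕ)
    (n : ℕ) : ℝ≥0∞ := cellInf ν idx (initSeg x n) + ∑ i ∈ Finset.range n, penalty z x i

/-- The norm on the space of branches. -/
def branchNorm {A : Type*} (ν : A → ℝ≥0∞) (idx : A → ℕ → ℕ) (z : List ℕ → ℕ)
    (x : Branch (range idx) z) : ℝ≥0∞ :=
  (⨆ n, cellInf ν idx (initSeg x.1 n)) + ∑' i, penalty z x.1 i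

section BranchNorm

variable {A : Type*} {ν : A → ℝ≥0∞} {idx : A → ℕ → ℕ} {z : List ℕ → ℕ} {x y : ℕ → ℕ} {n : ℕ}

theorem cellInf_initSeg_le {a : A} (h : initSeg (idx a) n = initSeg x n) :
    cellInf ν idx (initSeg x n) ≤ ν a := infOn_le (by simpa using h)

theorem exists_lt_of_cellInf_lt {r : ℝ≥0∞} (h : cellInf ν idx (initSeg x n) < r) :
    ∃ a, initSeg (idx a) n = initSeg x n ∧ ν a < r := by
  obtain ⟨a, ha, har⟩ := exists_lt_of_infOn_lt h
  exact ⟨a, by simpa using ha, har⟩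

theorem monotone_cellInf (x : ℕ → ℕ) : Monotone fun n => cellInf ν idx (initSeg x n) := by
  intro m n hmn
  refine infOn_anti fun a ha => ?_
  have ha' : initSeg (idx a) (initSeg x n).length = initSeg x n := ha
  rw [length_initSeg] at ha'
  change initSeg (idx a) (initSeg x m).length = initSeg x m
  rw [length_initSeg]
  exact initSeg_eq_of_le ha' hmn

theorem penalty_congr {i : ℕ} (h : initSeg x (i + 1) = initSeg y (i + 1)) :
    penalty z x i = penalty z y i := by
  rw [penalty, penalty, initSeg_eq_iff.1 h i i.lt_succ_self, initSeg_eq_of_le h i.le_succ]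

theorem penalty_le (z : List ℕ → ℕ) (x : ℕ → ℕ) (i : ℕ) : penalty z x i ≤ 3 * 2⁻¹ ^ i := by
  rw [penalty]
  split_ifs <;> simp

theorem tsum_penaltyBound_ne_top : ∑' i : ℕ, (3 * 2⁻¹ ^ i : ℝ≥0∞) ≠ ∞ := by
  rw [ENNReal.tsum_mul_left, ENNReal.tsum_geometric, ENNReal.one_sub_inv_two, inv_inv]
  exact ENNReal.mul_ne_top (by simp) (by simp)

theorem partialNorm_congr (h : initSeg x n = initSeg y n) :
    partialNorm ν idx z x n = partialNorm ν idx z y n := by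
  rw [partialNorm, partialNorm, h]
  congr 1
  exact Finset.sum_congr rfl fun i hi =>
    penalty_congr (initSeg_eq_of_le h (Finset.mem_range.1 hi))

theorem branchNorm_eq_iSup (x : Branch (range idx) z) :
    branchNorm ν idx z x = ⨆ n, partialNorm ν idx z x.1 n := by
  rw [branchNorm, ENNReal.tsum_eq_iSup_nat]
  exact ENNReal.iSup_add_iSup_of_monotone (monotone_cellInf x.1)
    fun m n h => Finset.sum_le_sum_of_subset (Finset.range_mono h)

theorem monotone_partialNorm (x : ℕ → ℕ) : Monotone (partialNorm ν idx z x) := fun _ _ h =>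
  add_le_add (monotone_cellInf x h) (Finset.sum_le_sum_of_subset (Finset.range_mono h))

theorem partialNorm_add_le_branchNorm {x : Branch (range idx) z}
    (h : x.1 n ≠ z (initSeg x.1 n)) :
    partialNorm ν idx z x.1 n + 3 * 2⁻¹ ^ n ≤ branchNorm ν idx z x := by
  rw [branchNorm_eq_iSup]
  refine le_trans ?_ (le_iSup _ (n + 1))
  rw [partialNorm, partialNorm, Finset.sum_range_succ, add_assoc]
  gcongr
  · exact monotone_cellInf x.1 n.le_succ
  · simp [penalty, h]

/-- Passing to the limit successor increases the infimum of `ν` only slightly. -/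
def IsLimitSuccessor (ν : A → ℝ≥0∞) (idx : A → ℕ → ℕ) (z : List ℕ → ℕ) : Prop :=
  ∀ a n, ∃ b, initSeg (idx b) (n + 1) = initSeg (idx a) n ++ [z (initSeg (idx a) n)] ∧
    ν b ≤ cellInf ν idx (initSeg (idx a) n) + 2⁻¹ ^ n

theorem exists_isLimitSuccessor (hν : ∀ a, ν a ≠ ∞) : ∃ z, IsLimitSuccessor ν idx z := by
  have h : ∀ σ : List ℕ, ∃ j, ∀ a, initSeg (idx a) σ.length = σ →
      ∃ b, initSeg (idx b) (σ.length + 1) = σ ++ [j] ∧ ν b ≤ cellInf ν idx σ + 2⁻¹ ^ σ.length := by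
    intro σ
    by_cases hσ : ∃ a, initSeg (idx a) σ.length = σ
    · obtain ⟨a, ha⟩ := hσ
      have hlt : cellInf ν idx σ < cellInf ν idx σ + 2⁻¹ ^ σ.length :=
        ENNReal.lt_add_right (ne_top_of_le_ne_top (hν a) (infOn_le ha)) (by simp)
      obtain ⟨b, hb, hbν⟩ := exists_lt_of_infOn_lt hlt
      exact ⟨idx b σ.length, fun _ _ => ⟨b, initSeg_succ_eq_append_iff.2 ⟨hb, rfl⟩, hbν.le⟩⟩
    · exact ⟨0, fun a ha => absurd ⟨a, ha⟩ hσ⟩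
  choose z hz using h
  refine ⟨z, fun a n => ?_⟩
  simpa using hz (initSeg (idx a) n) a (by simp)

theorem IsLimitSuccessor.branchNorm_le (hz : IsLimitSuccessor ν idx z) {x : Branch (range idx) z}
    (h : ∀ m, n ≤ m → x.1 m = z (initSeg x.1 m)) :
    branchNorm ν idx z x ≤ partialNorm ν idx z x.1 n + 2 * 2⁻¹ ^ n := by
  have hstep : ∀ m, n ≤ m →
      partialNorm ν idx z x.1 (m + 1) ≤ partialNorm ν idx z x.1 m + 2⁻¹ ^ m := by
    intro m hm
    obtain ⟨_, ⟨a, rfl⟩, ha⟩ := x.2 m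
    obtain ⟨b, hb, hbν⟩ := hz a m
    rw [ha, ← h m hm, ← initSeg_succ] at hb
    rw [ha] at hbν
    have hp : penalty z x.1 m = 0 := if_pos (h m hm)
    rw [partialNorm, partialNorm, Finset.sum_range_succ, hp, add_zero, add_right_comm]
    gcongr
    exact (cellInf_initSeg_le hb).trans hbν
  have hle : ∀ m, n ≤ m → partialNorm ν idx z x.1 m + 2 * 2⁻¹ ^ m ≤
      partialNorm ν idx z x.1 n + 2 * 2⁻¹ ^ n := by
    intro m hm
    induction m, hm using Nat.le_induction with
    | base => exact le_rfl
    | succ m hm ih =>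
      refine le_trans ?_ ih
      have h2 : (2 : ℝ≥0∞) * 2⁻¹ ^ (m + 1) = 2⁻¹ ^ m := by
        rw [pow_succ', ← mul_assoc, ENNReal.mul_inv_cancel (by simp) (by simp), one_mul]
      rw [h2, two_mul, ← add_assoc]
      gcongr
      exact hstep m hm
  rw [branchNorm_eq_iSup]
  refine iSup_le fun m => ?_
  rcases le_total n m with hm | hm
  · exact le_self_add.trans (hle m hm)
  · exact (monotone_partialNorm x.1 hm).trans le_self_add

theorem IsLimitSuccessor.initSeg_or_branchNorm_le (hz : IsLimitSuccessor ν idx z)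
    {x : Branch (range idx) z} {l : Ultrafilter (Branch (range idx) z)}
    (hl : (l : Filter _) ≤ 𝓝 x) :
    (∀ n, ∀ᶠ y in (l : Filter (Branch (range idx) z)), initSeg y.1 n = initSeg x.1 n) ∨
    ∃ n, ∀ᶠ y in (l : Filter (Branch (range idx) z)),
      branchNorm ν idx z x + 2⁻¹ ^ n ≤ branchNorm ν idx z y := by
  refine (Branch.initSeg_or_exists_leave hl).imp_right ?_
  rintro ⟨n, htail, hn⟩
  refine ⟨n, hn.mono fun y hy => ?_⟩
  calc branchNorm ν idx z x + 2⁻¹ ^ n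
      ≤ partialNorm ν idx z x.1 n + 2 * 2⁻¹ ^ n + 2⁻¹ ^ n := by
        gcongr
        exact hz.branchNorm_le htail
    _ = partialNorm ν idx z y.1 n + 3 * 2⁻¹ ^ n := by rw [partialNorm_congr hy.1]; ring
    _ ≤ branchNorm ν idx z y := partialNorm_add_le_branchNorm hy.2

theorem IsLimitSuccessor.lowerSemicontinuous (hz : IsLimitSuccessor ν idx z) :
    LowerSemicontinuous (branchNorm ν idx z) := by
  intro x r hr
  refine mem_iff_ultrafilter.2 fun l hl => ?_
  rcases hz.initSeg_or_branchNorm_le hl with h | ⟨n, h⟩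
  · rw [gt_iff_lt, branchNorm_eq_iSup, lt_iSup_iff] at hr
    obtain ⟨n, hn⟩ := hr
    filter_upwards [h n] with y hy
    rw [← partialNorm_congr hy] at hn
    exact hn.trans_le ((le_iSup (partialNorm ν idx z y.1) n).trans (branchNorm_eq_iSup y).ge)
  · filter_upwards [h] with y hy
    exact hr.trans_le (le_self_add.trans hy)

theorem IsLimitSuccessor.compactSpace [Nonempty A] (hz : IsLimitSuccessor ν idx z) :
    CompactSpace (Branch (range idx) z) := by
  refine Branch.compactSpace ?_ (range_nonempty idx)
  rintro _ ⟨a, rfl⟩ n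
  obtain ⟨b, hb, -⟩ := hz a n
  exact ⟨_, ⟨b, rfl⟩, hb⟩

variable [TopologicalSpace A]

theorem IsCoding.iSup_cellInf (h : IsCoding ν idx) (a : A) :
    ⨆ n, cellInf ν idx (initSeg (idx a) n) = ν a := by
  have hle : ⨆ n, cellInf ν idx (initSeg (idx a) n) ≤ ν a :=
    iSup_le fun n => cellInf_initSeg_le rfl
  have hne := ne_top_of_le_ne_top (h.ne_top a) hle
  obtain ⟨b, hb, hbν⟩ := h.exists_eq (idx a) _ hne fun n => exists_lt_of_cellInf_lt <|
    (le_iSup (fun n => cellInf ν idx (initSeg (idx a) n)) n).trans_lt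
      (ENNReal.lt_add_right hne (by simp))
  rw [h.injective hb] at hbν
  exact hle.antisymm hbν

theorem tendsto_tsum_penalty {α : Type*} {l : Filter α} {g : α → ℕ → ℕ}
    (h : Tendsto g l (𝓝 x)) :
    Tendsto (fun u => ∑' i, penalty z (g u) i) l (𝓝 (∑' i, penalty z x i)) := by
  refine ENNReal.tendsto_tsum_of_le (b := fun i => 3 * 2⁻¹ ^ i) (fun i => ?_)
    (.of_forall fun u => penalty_le z (g u)) tsum_penaltyBound_ne_top
  exact tendsto_const_nhds.congr' ((tendsto_nhds_iff_initSeg.1 h (i + 1)).mono fun u hu =>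
    (penalty_congr hu).symm)

theorem IsCoding.nonempty_homeomorph (h : IsCoding ν idx) (hz : IsLimitSuccessor ν idx z) :
    Nonempty (A ≃ₜ GraphDomain (branchNorm ν idx z)) := by
  let b : A → Branch (range idx) z := fun a => ⟨idx a, fun n => ⟨_, ⟨a, rfl⟩, rfl⟩⟩
  have hb : ∀ a, branchNorm ν idx z (b a) = ν a + ∑' i, penalty z (idx a) i := fun a => by
    rw [branchNorm, h.iSup_cellInf]
  let j : A → GraphDomain (branchNorm ν idx z) := fun a => ⟨b a, by
    rw [hb]
    exact ENNReal.add_ne_top.2 ⟨h.ne_top a, ne_top_of_le_ne_top tsum_penaltyBound_ne_top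
      (ENNReal.tsum_le_tsum (penalty_le z (idx a)))⟩⟩
  have hj : Continuous j := by
    refine GraphDomain.continuous_iff.2 ⟨?_, ?_⟩
    · exact continuous_iff_continuousAt.2 fun a => Branch.tendsto_of_initSeg
        (tendsto_nhds_iff_initSeg.1 h.continuous_idx.continuousAt)
    · refine continuous_iff_continuousAt.2 fun a => ?_
      simp only [ContinuousAt, j, hb]
      exact h.continuous_norm.continuousAt.add
        (tendsto_tsum_penalty h.continuous_idx.continuousAt)
  have hinj : Function.Injective j := fun a a' haa' =>
    h.injective (congrArg (fun y : GraphDomain (branchNorm ν idx z) => y.1.1) haa')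
  have hsurj : Function.Surjective j := by
    rintro ⟨x, hx⟩
    have hne : ⨆ n, cellInf ν idx (initSeg x.1 n) ≠ ∞ := ne_top_of_le_ne_top hx le_self_add
    obtain ⟨a, ha, -⟩ := h.exists_eq x.1 _ hne fun n => exists_lt_of_cellInf_lt <|
      (le_iSup (fun n => cellInf ν idx (initSeg x.1 n)) n).trans_lt
        (ENNReal.lt_add_right hne (by simp))
    exact ⟨a, Subtype.ext (Subtype.ext ha)⟩
  have hind : IsInducing j := by
    refine isInducing_iff_nhds.2 fun a => le_antisymm hj.continuousAt.le_comap ?_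
    refine le_iff_ultrafilter.2 fun l hl => ?_
    obtain ⟨h1, h2⟩ := GraphDomain.tendsto_iff.1 (tendsto_iff_comap.2 hl)
    have hidx : Tendsto idx l (𝓝 (idx a)) := by
      rcases hz.initSeg_or_branchNorm_le (l := l.map b) h1 with h' | ⟨n, h'⟩
      · exact tendsto_nhds_iff_initSeg.2 h'
      · have hlt := h2.eventually_lt_const (ENNReal.lt_add_right (j a).2 (b := 2⁻¹ ^ n) (by simp))
        obtain ⟨u, hu1, hu2⟩ := (hlt.and h').exists
        exact absurd hu2 hu1.not_ge
    refine h.le_nhds a l hidx ?_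
    have hpen := tendsto_tsum_penalty (z := z) hidx
    simp only [j, hb] at h2
    refine ENNReal.tendsto_of_tendsto_add (fun r hr => ?_) (tendsto_order.1 hpen).1 h2
      (hb a ▸ (j a).2)
    rw [← h.iSup_cellInf, lt_iSup_iff] at hr
    obtain ⟨n, hn⟩ := hr
    filter_upwards [tendsto_nhds_iff_initSeg.1 hidx n] with u hu
    exact hn.trans_le (cellInf_initSeg_le hu)
  exact ⟨(Equiv.ofBijective j ⟨hinj, hsurj⟩).toHomeomorphOfIsInducing hind⟩

theorem IsCoding.exists_mem_branchNorm_ne_top (h : IsCoding ν idx)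
    {U : Set (Branch (range idx) z)} (hU : IsOpen U) (hne : U.Nonempty) :
    ∃ x ∈ U, branchNorm ν idx z x ≠ ∞ := by
  obtain ⟨x, hxU, a, ha⟩ := Branch.exists_mem_of_isOpen hU hne
  refine ⟨x, hxU, ?_⟩
  rw [branchNorm, ← ha, h.iSup_cellInf]
  exact ENNReal.add_ne_top.2 ⟨h.ne_top a, ne_top_of_le_ne_top tsum_penaltyBound_ne_top
    (ENNReal.tsum_le_tsum (penalty_le z (idx a)))⟩

end BranchNorm

section ClosedCoding

variable {C A : Type*} [TopologicalSpace C] [CompactSpace C] [T2Space C]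
  [TotallyDisconnectedSpace C]

theorem le_nhds_of_forall_clopens {l : Filter C} {c : C}
    (h : ∀ U : TopologicalSpace.Clopens C, c ∈ U → ∀ᶠ x in l, x ∈ U) : l ≤ 𝓝 c := by
  intro U hU
  obtain ⟨O, hOU, hO, hcO⟩ := mem_nhds_iff.1 hU
  obtain ⟨V, hV, hcV, hVO⟩ := compact_exists_isClopen_in_isOpen hO hcO
  exact (h ⟨V, hV⟩ hcV).mono fun x hx => hOU (hVO hx)

variable [SecondCountableTopology C] {N : C → ℝ≥0∞}

theorem LowerSemicontinuous.exists_clopen_cells [Nonempty A] (hN : LowerSemicontinuous N)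
    (v : A → C) (hv : ∀ a, N (v a) ≠ ∞) {B : A → Set C} (hB : ∀ a, IsClopen (B a))
    (hvB : ∀ a, v a ∈ B a) {ε : ℝ≥0∞} (hε : ε ≠ 0) :
    ∃ (V : ℕ → Set C) (wit : ℕ → A), (∀ j, IsClopen (V j)) ∧ (∀ j, V j ⊆ B (wit j)) ∧
      (∀ j, v (wit j) ∈ V j) ∧ (∀ j, ∀ y ∈ V j, N (v (wit j)) < N y + ε) ∧
      ∀ a, ∃ j, v a ∈ V j := by
  have hopen : ∀ a, IsOpen {y | N (v a) < N y + ε} := fun a =>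
    (hN.add lowerSemicontinuous_const).isOpen_preimage (N (v a))
  choose W hW haW hWN using fun a => compact_exists_isClopen_in_isOpen (hopen a)
    (ENNReal.lt_add_right (hv a) hε : v a ∈ {y | N (v a) < N y + ε})
  obtain ⟨T, hT, hTW⟩ := TopologicalSpace.isOpen_iUnion_countable (fun a => W a ∩ B a)
    fun a => ((hW a).inter (hB a)).isOpen
  have hmem : ∀ a, ∃ i ∈ T, v a ∈ W i ∩ B i := fun a => by
    have h : v a ∈ ⋃ i ∈ T, W i ∩ B i := hTW ▸ mem_iUnion.2 ⟨a, haW a, hvB a⟩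
    simpa only [mem_iUnion₂, exists_prop] using h
  obtain ⟨i, hi, -⟩ := hmem (Classical.arbitrary A)
  obtain ⟨wit, rfl⟩ := hT.exists_eq_range ⟨i, hi⟩
  refine ⟨fun j => W (wit j) ∩ B (wit j), wit, fun j => (hW _).inter (hB _),
    fun j => inter_subset_right, fun j => ⟨haW _, hvB _⟩, fun j y hy => hWN _ hy.1, fun a => ?_⟩
  obtain ⟨_, ⟨j, rfl⟩, hj⟩ := hmem a
  exact ⟨j, hj⟩

theorem Topology.IsClosedEmbedding.exists_isCoding [Nonempty A] [TopologicalSpace A]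
    (hN : LowerSemicontinuous N) {e : A → GraphDomain N} (he : IsClosedEmbedding e) :
    ∃ idx : A → ℕ → ℕ, IsCoding (fun a => N (e a).1) idx := by
  classical
  have : Countable (TopologicalSpace.Clopens C) :=
    TopologicalSpace.Clopens.countable_iff_secondCountable.2 inferInstance
  obtain ⟨G, hG⟩ := exists_surjective_nat (TopologicalSpace.Clopens C)
  let B : ℕ → A → Set C := fun n a => ⋂ i ∈ Finset.range (n + 1), {y | y ∈ G i ↔ (e a).1 ∈ G i}
  have hB : ∀ n a, IsClopen (B n a) := fun n a => by
    refine isClopen_biInter_finset fun i _ => ?_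
    by_cases h : (e a).1 ∈ G i
    · simpa [h] using (G i).isClopen
    · simp only [h, iff_false]
      exact (G i).isClopen.compl
  have hε : ∀ n : ℕ, (2⁻¹ ^ n : ℝ≥0∞) ≠ 0 := fun n => by simp
  choose V wit hV hVB hwV hwN hcov using fun n =>
    hN.exists_clopen_cells (fun a => (e a).1) (fun a => (e a).2) (hB n) (by simp [B]) (hε n)
  have hval : Continuous fun a => (e a).1 := GraphDomain.continuous_val.comp he.continuous
  have hGmem : ∀ {i n j : ℕ} {c y : C}, i ≤ n → c ∈ V n j → y ∈ V n j → c ∈ G i → y ∈ G i := by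
    intro i n j c y hin hc hy hcG
    have h : ∀ {y}, y ∈ V n j → (y ∈ G i ↔ (e (wit n j)).1 ∈ G i) := fun hy =>
      mem_iInter₂.1 (hVB n j hy) i (Finset.mem_range_succ_iff.2 hin)
    exact (h hy).2 ((h hc).1 hcG)
  have hlim : ∀ {l : Filter C} {c : C} {x : ℕ → ℕ},
      (∀ n, c ∈ V n (x n)) → (∀ n, ∀ᶠ y in l, y ∈ V n (x n)) → l ≤ 𝓝 c := by
    intro l c x hc hf
    refine le_nhds_of_forall_clopens fun U hU => ?_
    obtain ⟨n, rfl⟩ := hG U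
    exact (hf n).mono fun y hy => hGmem le_rfl (hc n) hy hU
  let idx : A → ℕ → ℕ := fun a n => Nat.find (hcov n a)
  have hidx : ∀ a n, (e a).1 ∈ V n (idx a n) := fun a n => Nat.find_spec (hcov n a)
  have hidx_iff : ∀ a n j, idx a n = j ↔ (e a).1 ∈ V n j ∧ ∀ i < j, (e a).1 ∉ V n i :=
    fun a n j => Nat.find_eq_iff (hcov n a)
  refine ⟨idx, fun a => (e a).2, GraphDomain.continuous_apply.comp he.continuous, ?_, ?_, ?_, ?_⟩
  · refine continuous_pi fun n => continuous_discrete_rng.2 fun j => ?_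
    have heq : (fun a => idx a n) ⁻¹' {j} =
        (fun a => (e a).1) ⁻¹' (V n j ∩ ⋂ i ∈ Finset.range j, (V n i)ᶜ) := by
      ext a
      simp [hidx_iff]
    rw [heq]
    exact ((hV n j).isOpen.inter
      (isOpen_biInter_finset fun i _ => (hV n i).compl.isOpen)).preimage hval
  · intro a b hab
    refine he.injective (Subtype.ext ?_)
    have h : pure (e b).1 ≤ 𝓝 (e a).1 := hlim (hidx a) fun n => by
      rw [eventually_pure, hab]
      exact hidx b n
    exact (pure_le_nhds_iff.1 h).symm
  · intro a l hl hνl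
    have h : Tendsto e l (𝓝 (e a)) := by
      refine GraphDomain.tendsto_iff.2 ⟨hlim (hidx a) fun n => ?_, hνl⟩
      have hn : Tendsto (fun b => idx b n) l (pure (idx a n)) := by
        simpa using tendsto_pi_nhds.1 hl n
      rw [eventually_map]
      filter_upwards [tendsto_pure.1 hn] with b hb
      rw [← hb]
      exact hidx b n
    exact (he.isInducing.tendsto_nhds_iff (f := id)).2 h
  · intro x s hs hx
    choose a ha has using hx
    have hax : ∀ {n m : ℕ}, n < m → idx (a m) n = x n := fun hnm => initSeg_eq_iff.1 (ha _) _ hnm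
    obtain ⟨c, hc⟩ := exists_clusterPt_of_compactSpace (map (fun m => (e (a m)).1) atTop)
    have hclosed : ∀ {K : Set C}, IsClosed K → (∀ᶠ m in atTop, (e (a m)).1 ∈ K) → c ∈ K :=
      fun hK h => isClosed_iff_clusterPt.1 hK c (hc.mono (le_principal_iff.2 h))
    have haV : ∀ n, ∀ᶠ m in atTop, (e (a m)).1 ∈ V n (x n) := fun n => by
      filter_upwards [eventually_gt_atTop n] with m hm
      rw [← hax hm]
      exact hidx _ n
    have hcV : ∀ n, c ∈ V n (x n) := fun n => hclosed (hV n _).isClosed (haV n)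
    have hcV' : ∀ n, ∀ i < x n, c ∉ V n i := fun n i hi =>
      hclosed (hV n i).compl.isClosed <| by
        filter_upwards [eventually_gt_atTop n] with m hm
        exact ((hidx_iff _ _ _).1 (hax hm)).2 i hi
    have hpow : ∀ t : ℝ≥0∞, Tendsto (fun n : ℕ => t + 2⁻¹ ^ n) atTop (𝓝 t) := fun t => by
      simpa using (ENNReal.tendsto_pow_atTop_nhds_zero_of_lt_one
        (r := 2⁻¹) (by simp)).const_add t
    have hac : Tendsto (fun m => (e (a m)).1) atTop (𝓝 c) := hlim hcV haV
    have hNc : N c ≤ s := by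
      refine le_of_forall_lt fun r hr => lt_of_not_ge fun hsr => ?_
      obtain ⟨t, hrt, htc⟩ := exists_between hr
      obtain ⟨m, hm, hm'⟩ := ((hN.eventually_lt hac t htc).and
        ((hpow s).eventually_lt_const (hsr.trans_lt hrt))).exists
      exact lt_asymm hm ((has m).trans hm')
    have hwc : Tendsto (fun m => (e (wit m (x m))).1) atTop (𝓝 c) := by
      refine le_nhds_of_forall_clopens fun U hU => ?_
      obtain ⟨i, rfl⟩ := hG U
      rw [eventually_map]
      filter_upwards [eventually_ge_atTop i] with m hm
      exact hGmem hm (hcV m) (hwV m _) hU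
    let p : GraphDomain N := ⟨c, ne_top_of_le_ne_top hs hNc⟩
    have hwp : Tendsto (fun m => e (wit m (x m))) atTop (𝓝 p) := by
      refine GraphDomain.tendsto_iff.2 ⟨hwc, tendsto_order.2 ⟨hN.eventually_lt hwc, fun r hr => ?_⟩⟩
      filter_upwards [(hpow (N c)).eventually_lt_const hr] with m hm
      exact (hwN m _ c (hcV m)).trans hm
    obtain ⟨b, hb⟩ := he.isClosed_range.mem_of_tendsto hwp
      (Eventually.of_forall fun m => mem_range_self _)
    have hbc : (e b).1 = c := by rw [hb]
    refine ⟨b, funext fun n => (hidx_iff b n (x n)).2 ?_, ?_⟩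
    · rw [hbc]
      exact ⟨hcV n, hcV' n⟩
    · simpa only [hbc] using hNc

end ClosedCoding

/-- A nonempty closed subspace of the graph domain of a lower semicontinuous function on a
zero-dimensional compact metrizable space is a factor of complete Erdős space. -/
theorem Topology.IsClosedEmbedding.nonempty_prod_completeErdos_homeomorph {C A : Type*}
    [TopologicalSpace C] [CompactSpace C] [T2Space C] [TotallyDisconnectedSpace C]
    [SecondCountableTopology C] {N : C → ℝ≥0∞} [Nonempty A] [TopologicalSpace A]
    (hN : LowerSemicontinuous N) {e : A → GraphDomain N} (he : IsClosedEmbedding e) :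
    Nonempty ((A × CompleteErdosSpace) ≃ₜ CompleteErdosSpace) := by
  obtain ⟨idx, hidx⟩ := he.exists_isCoding hN
  obtain ⟨z, hz⟩ := exists_isLimitSuccessor (idx := idx) hidx.ne_top
  obtain ⟨f⟩ := hidx.nonempty_homeomorph hz
  have := hz.compactSpace
  have : Nonempty (Branch (range idx) z) := ⟨(f (Classical.arbitrary A)).1⟩
  have : Nonempty (ℕ → HarmonicSeq) := ⟨fun _ => ⟨0, zero_mem_harmonicSeq⟩⟩
  have hprod := IsLelek.prod hz.lowerSemicontinuous
    (fun _ hU hne => hidx.exists_mem_branchNorm_ne_top hU hne) isLelek_sqNorm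
  obtain ⟨g⟩ := hprod.nonempty_homeomorph isLelek_sqNorm
  exact ⟨(f.prodCongr completeErdosHomeomorph).trans
    ((GraphDomain.prodHomeomorph hz.lowerSemicontinuous lowerSemicontinuous_sqNorm).trans
      (g.trans completeErdosHomeomorph.symm))⟩

theorem isClosedEmbedding_prodMk_left {X Z : Type*} [TopologicalSpace X] [TopologicalSpace Z]
    [T1Space Z] (z : Z) : IsClosedEmbedding fun x : X => (x, z) := by
  refine ⟨isEmbedding_prodMkLeft z, ?_⟩
  have : range (fun x : X => (x, z)) = Prod.snd ⁻¹' {z} := by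
    ext ⟨x, y⟩
    simp [eq_comm]
  rw [this]
  exact isClosed_singleton.preimage continuous_snd

/-- If `X` is a separable metrizable `𝔈_c`-factor, then so is `F_n(X)` for every `n ≥ 1`. -/
theorem hypFn_completeErdos_factor {X : Type*} [TopologicalSpace X]
    [TopologicalSpace.MetrizableSpace X] [TopologicalSpace.SeparableSpace X]
    (n : ℕ) (hn : 1 ≤ n)
    (h : ∃ (Z : Type) (_ : TopologicalSpace Z), Nonempty ((X × Z) ≃ₜ CompleteErdosSpace)) :
    ∃ (Z : Type) (_ : TopologicalSpace Z),
      Nonempty ((HypFn n X × Z) ≃ₜ CompleteErdosSpace) := by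
  obtain ⟨Z, _, ⟨f⟩⟩ := h
  have : T2Space (GraphDomain sqNorm) :=
    .of_injective_continuous Subtype.val_injective GraphDomain.continuous_val
  have : T1Space (X × Z) := (f.trans completeErdosHomeomorph).isEmbedding.t1Space
  let x₀ : GraphDomain sqNorm := ⟨fun _ => ⟨0, zero_mem_harmonicSeq⟩, by simp [sqNorm]⟩
  obtain ⟨a, z⟩ := f.symm (completeErdosHomeomorph.symm x₀)
  have : T1Space Z := (isEmbedding_prodMkRight a).t1Space
  have he := (f.trans completeErdosHomeomorph).isClosedEmbedding.comp
    (isClosedEmbedding_prodMk_left (X := X) z)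
  have : Countable (TopologicalSpace.Clopens (ℕ → HarmonicSeq)) :=
    TopologicalSpace.Clopens.countable_iff_secondCountable.2 inferInstance
  obtain ⟨w, hw0, hw⟩ := ENNReal.exists_pos_sum_of_countable' one_ne_zero
    (TopologicalSpace.Clopens (ℕ → HarmonicSeq))
  have hwt : ∑' U, w U ≠ ∞ := hw.ne_top
  obtain ⟨g⟩ := HypFn.nonempty_homeomorph_graphDomain (n := n) lowerSemicontinuous_sqNorm
    (fun U => (hw0 U).ne') hwt
  have : CompactSpace (HypFn n (ℕ → HarmonicSeq)) := HypFn.compactSpace hn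
  have : T2Space (HypFn n (ℕ → HarmonicSeq)) := HypFn.t2Space
  have : TotallyDisconnectedSpace (HypFn n (ℕ → HarmonicSeq)) := HypFn.totallyDisconnectedSpace hn
  have : SecondCountableTopology (HypFn n (ℕ → HarmonicSeq)) := HypFn.secondCountableTopology hn
  have : Nonempty (HypFn n X) :=
    ⟨⟨{a}, singleton_nonempty a, finite_singleton a, by rwa [ncard_singleton]⟩⟩
  exact ⟨CompleteErdosSpace, inferInstance,
    (g.isClosedEmbedding.comp (HypFn.isClosedEmbedding_map he)
      ).nonempty_prod_completeErdos_homeomorph (lowerSemicontinuous_hypNorm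
        lowerSemicontinuous_sqNorm (ENNReal.ne_top_of_tsum_ne_top hwt))⟩
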